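/- arXiv:1210.6795 — 3 statements merged into one kernel-verified Lean document; each statement's English description precedes it below -/
import Mathlib

section
/- Let W: ℝ^N → [0, +∞] be nonnegative (H1'), lower semicontinuous (H2), uniformly locally integrable in the sense that there exists M > 0 with ∫_{B(x,1)} W(y) dy ≤ M for all x ∈ ℝ^N (H3), and satisfy (H4): there exists C* > 0 such that Δ^ε W(x) < C* for all x ∈ ℝ^N and all ε ∈ (0,1). Let μ ∈ P(ℝ^N) and suppose x₀ ∈ ℝ^N is a local minimizer of V_μ = W∗μ in the sense that there exists ε₀ > 0 with V_μ(x₀) ≤ V_μ(x) for Lebesgue-almost every x ∈ B(x₀, ε₀). Then (Δ⁰W ∗ μ)(x₀) ≥ 0. -/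
open MeasureTheory Metric Set Filter
open scoped ENNReal NNReal Topology

noncomputable section

/-- `ℝ^N` with the Euclidean structure. -/
abbrev Euc (N : ℕ) := EuclideanSpace ℝ (Fin N)

/-- The positive part of an extended real number, as an element of `ℝ≥0∞`. -/
def erealPos (x : EReal) : ℝ≥0∞ := if x = ⊤ then ⊤ else ENNReal.ofReal x.toReal

/-- Extended integral of an `EReal`-valued function: the integral of the positive part minus
the integral of the negative part. -/
def eint {X : Type*} [MeasurableSpace X] (μ : Measure X) (f : X → EReal) : EReal :=
  ((∫⁻ x, erealPos (f x) ∂μ : ℝ≥0∞) : EReal) - ((∫⁻ x, erealPos (-(f x)) ∂μ : ℝ≥0∞) : EReal)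

/-- The support of a measure: the points all of whose balls have positive measure. -/
def msupp {X : Type*} [PseudoMetricSpace X] [MeasurableSpace X] (μ : Measure X) : Set X :=
  {x | ∀ ε > 0, 0 < μ (ball x ε)}

/-- The set `Π(μ,ν)` of transference plans between two measures. -/
def plans {X : Type*} [MeasurableSpace X] (μ ν : Measure X) : Set (Measure (X × X)) :=
  {π | IsProbabilityMeasure π ∧ π.map Prod.fst = μ ∧ π.map Prod.snd = ν}

/-- The `∞`-Wasserstein distance
`d_∞(μ,ν) = inf_{π ∈ Π(μ,ν)} sup_{(x,y) ∈ supp π} |x-y|`. -/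
def dInfty {X : Type*} [PseudoMetricSpace X] [MeasurableSpace X] (μ ν : Measure X) : ℝ≥0∞ :=
  ⨅ π ∈ plans μ ν, ⨆ p ∈ msupp π, edist p.1 p.2

/-- The interaction bilinear form `B_W[μ,ν] = (1/2)∬ W(x-y) dμ(x) dν(y)`. -/
def Bform {N : ℕ} (W : Euc N → EReal) (μ ν : Measure (Euc N)) : EReal :=
  ((2⁻¹ : ℝ) : EReal) * eint (μ.prod ν) (fun p => W (p.1 - p.2))

/-- The interaction energy `E_W[μ] = (1/2)∬ W(x-y) dμ(x) dμ(y)`. -/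
def interEnergy {N : ℕ} (W : Euc N → EReal) (μ : Measure (Euc N)) : EReal :=
  Bform W μ μ

/-- `T_W[μ,ν] = E_W[μ] - 2 B_W[μ,ν] + E_W[ν]`. -/
def Tform {N : ℕ} (W : Euc N → EReal) (μ ν : Measure (Euc N)) : EReal :=
  Bform W μ μ - ((2 : ℝ) : EReal) * Bform W μ ν + Bform W ν ν

/-- `μ` is a local minimizer of `E_W` with respect to the `d_∞` topology. -/
def IsLocalMinEnergy {N : ℕ} (W : Euc N → EReal) (μ : Measure (Euc N)) : Prop :=
  ∃ δ : ℝ≥0∞, 0 < δ ∧ ∀ ν : Measure (Euc N), IsProbabilityMeasure ν →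
    dInfty μ ν < δ → interEnergy W μ ≤ interEnergy W ν

/-- `V_μ = W ∗ μ`, i.e. `V_μ(x) = ∫ W(x-y) dμ(y)`. -/
def Wconv {N : ℕ} (W : Euc N → EReal) (μ : Measure (Euc N)) (x : Euc N) : EReal :=
  eint μ (fun y => W (x - y))

/-- Average of an `EReal`-valued function over the ball `B(x,r)`. -/
def ballAvg {N : ℕ} (x : Euc N) (r : ℝ) (f : Euc N → EReal) : EReal :=
  (((volume (ball x r)).toReal⁻¹ : ℝ) : EReal) * eint (volume.restrict (ball x r)) f

/-- The approximate Laplacian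
`Δ^ε W(x) = (2(N+2)/ε²) (⨍_{B(0,ε)} W(x+y) dy - W(x))`. -/
def approxLap {N : ℕ} (W : Euc N → EReal) (ε : ℝ) (x : Euc N) : EReal :=
  ((2 * (N + 2) / ε ^ 2 : ℝ) : EReal) * (ballAvg 0 ε (fun y => W (x + y)) - W x)

/-- The negative generalized Laplacian `-Δ⁰W(x) = liminf_{n→∞} (-Δ^{1/n} W(x))`. -/
def negGenLap {N : ℕ} (W : Euc N → EReal) (x : Euc N) : EReal :=
  Filter.liminf (fun n : ℕ => -approxLap W (1 / n) x) Filter.atTop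

/-- `W` is `β`-repulsive at the origin: `-Δ⁰W(x) ≥ C/|x|^β` near `0`, and `-Δ⁰W(0) = +∞`. -/
def IsBetaRepulsive {N : ℕ} (W : Euc N → EReal) (β : ℝ) : Prop :=
  (∃ ε > 0, ∃ C > 0, ∀ x : Euc N, x ≠ 0 → ‖x‖ < ε →
    ((C / ‖x‖ ^ β : ℝ) : EReal) ≤ negGenLap W x) ∧ negGenLap W 0 = ⊤

theorem erealPos_eq_toENNReal (x : EReal) : erealPos x = x.toENNReal := rfl

theorem eint_coe_ennreal {X : Type*} [MeasurableSpace X] (μ : Measure X) (f : X → ℝ≥0∞) :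
    eint μ (fun x => (f x : EReal)) = ((∫⁻ x, f x ∂μ : ℝ≥0∞) : EReal) := by
  have h : ∀ x, (-(f x : EReal)).toENNReal = 0 := fun x =>
    EReal.toENNReal_of_nonpos
      (by simpa using EReal.neg_le_neg_iff.2 (EReal.coe_ennreal_nonneg (f x)))
  simp only [eint, erealPos_eq_toENNReal, h, EReal.toENNReal_coe, lintegral_zero,
    EReal.coe_ennreal_zero, sub_zero]

theorem setLIntegral_ball_eq_setLIntegral_ball_zero {N : ℕ} (f : Euc N → ℝ≥0∞) (x : Euc N)
    (r : ℝ) : ∫⁻ u in ball x r, f u = ∫⁻ u in ball 0 r, f (x + u) := by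
  rw [← lintegral_indicator measurableSet_ball, ← lintegral_indicator measurableSet_ball,
    ← lintegral_add_left_eq_self _ x]
  refine lintegral_congr fun u => ?_
  simp [indicator, mem_ball, dist_eq_norm]

theorem ballAvg_coe_ennreal {N : ℕ} (f : Euc N → ℝ≥0∞) (x : Euc N) {r : ℝ} (hr : 0 < r) :
    ballAvg x r (fun y => (f y : EReal)) =
      (((volume (ball x r))⁻¹ * ∫⁻ y in ball x r, f y : ℝ≥0∞) : EReal) := by
  rw [ballAvg, eint_coe_ennreal, EReal.coe_ennreal_mul, ← ENNReal.toReal_inv,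
    EReal.coe_ennreal_toReal]
  exact ENNReal.inv_ne_top.2 (measure_ball_pos _ _ hr).ne'

theorem neg_mul_sub_eq_coe_tsub {c C : ℝ} (hc : 0 < c) (hC : 0 ≤ C) {a w : ℝ≥0∞} (ha : a ≠ ⊤)
    (h : (c : EReal) * (a - w) ≤ C) :
    -((c : EReal) * (a - w)) =
      ((ENNReal.ofReal c * w + ENNReal.ofReal C - ENNReal.ofReal c * a : ℝ≥0∞) : EReal) - C := by
  lift a to ℝ≥0 using ha
  induction w with
  | top =>
    have h1 : ENNReal.ofReal c * ⊤ = ⊤ := ENNReal.mul_top (by simpa using hc)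
    have h2 : ENNReal.ofReal c * (a : ℝ≥0∞) ≠ ⊤ := by finiteness
    rw [h1, top_add, ENNReal.top_sub h2]
    simp [EReal.sub_top, EReal.coe_mul_bot_of_pos hc]
  | coe w =>
    have hle : c * ((a : ℝ) - w) ≤ C := by
      rw [EReal.coe_nnreal_eq_coe_real, EReal.coe_nnreal_eq_coe_real] at h
      exact_mod_cast h
    have e : ENNReal.ofReal c * (w : ℝ≥0∞) + ENNReal.ofReal C - ENNReal.ofReal c * (a : ℝ≥0∞)
        = ENNReal.ofReal (c * w + C - c * a) := by
      rw [ENNReal.ofReal_sub _ (by positivity), ENNReal.ofReal_add (by positivity) hC,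
        ENNReal.ofReal_mul hc.le, ENNReal.ofReal_mul hc.le]
      simp
    rw [e, EReal.coe_ennreal_ofReal, max_eq_left (by linarith)]
    have : -(c * ((a : ℝ) - w)) = (c * w + C - c * a) - C := by ring
    rw [EReal.coe_nnreal_eq_coe_real, EReal.coe_nnreal_eq_coe_real]
    exact_mod_cast congrArg (fun t : ℝ => (t : EReal)) this

theorem mul_le_mul_add_of_mul_sub_le {c C : ℝ} (hc : 0 < c) (hC : 0 ≤ C) {a w : ℝ≥0∞}
    (ha : a ≠ ⊤) (h : (c : EReal) * (a - w) ≤ C) :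
    ENNReal.ofReal c * a ≤ ENNReal.ofReal c * w + ENNReal.ofReal C := by
  lift a to ℝ≥0 using ha
  induction w with
  | top => simp [ENNReal.mul_top, hc]
  | coe w =>
    have hle : c * ((a : ℝ) - w) ≤ C := by
      rw [EReal.coe_nnreal_eq_coe_real, EReal.coe_nnreal_eq_coe_real] at h
      exact_mod_cast h
    have e : ENNReal.ofReal (c * a) ≤ ENNReal.ofReal (c * w + C) :=
      ENNReal.ofReal_le_ofReal (by linarith)
    rw [ENNReal.ofReal_add (by positivity) hC, ENNReal.ofReal_mul hc.le,
      ENNReal.ofReal_mul hc.le] at e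
    simpa using e

theorem liminf_coe_ennreal_sub {C : ℝ} (g : ℕ → ℝ≥0∞) :
    liminf (fun n => (g n : EReal) - C) atTop = (liminf g atTop : ℝ≥0∞) - (C : EReal) := by
  have hmono : Monotone fun t : ℝ≥0∞ => (t : EReal) - C := fun s t hst =>
    EReal.sub_le_sub (by exact_mod_cast hst) le_rfl
  have hcont : Continuous fun t : ℝ≥0∞ => (t : EReal) - C := by
    simp only [sub_eq_add_neg, ← EReal.coe_neg]
    refine continuous_iff_continuousAt.2 fun t => ?_
    exact (EReal.continuousAt_add (p := ((t : EReal), ((-C : ℝ) : EReal)))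
      (Or.inr (by simp)) (Or.inr (by simp))).comp
      (f := fun t : ℝ≥0∞ => ((t : EReal), ((-C : ℝ) : EReal)))
      (continuous_coe_ennreal_ereal.prodMk continuous_const).continuousAt
  exact (hmono.map_liminf_of_continuousAt g hcont.continuousAt).symm

theorem toENNReal_coe_sub_coe {C : ℝ} (hC : 0 ≤ C) (t : ℝ≥0∞) :
    ((t : EReal) - C).toENNReal = t - ENNReal.ofReal C := by
  induction t with
  | top => simp
  | coe t =>
    have : ((t : ℝ≥0∞) : EReal) - C = (((t : ℝ) - C : ℝ) : EReal) := by norm_cast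
    rw [this, EReal.toENNReal_of_ne_top (EReal.coe_ne_top _), EReal.toReal_coe,
      ENNReal.ofReal_sub _ hC]
    simp

theorem toENNReal_neg_coe_sub_coe {C : ℝ} (t : ℝ≥0∞) :
    (-((t : EReal) - C)).toENNReal = ENNReal.ofReal C - t := by
  induction t with
  | top => simp
  | coe t =>
    have : -(((t : ℝ≥0∞) : EReal) - C) = ((C - (t : ℝ) : ℝ) : EReal) := by
      rw [← neg_sub]; norm_cast
    rw [this, EReal.toENNReal_of_ne_top (EReal.coe_ne_top _), EReal.toReal_coe,
      ENNReal.ofReal_sub _ (NNReal.coe_nonneg t)]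
    simp

/-- An a.e. local lower bound for a convolution passes to averages over small balls. -/
theorem mul_lintegral_le_lintegral_setLIntegral {N : ℕ} {w : Euc N → ℝ≥0∞} (hw : Measurable w)
    (μ : Measure (Euc N)) [SFinite μ] (x₀ : Euc N) {r : ℝ}
    (h : ∀ᵐ x ∂(volume.restrict (ball x₀ r)),
      ∫⁻ y, w (x₀ - y) ∂μ ≤ ∫⁻ y, w (x - y) ∂μ) :
    (∫⁻ y, w (x₀ - y) ∂μ) * volume (ball (0 : Euc N) r) ≤
      ∫⁻ y, (∫⁻ u in ball 0 r, w (x₀ - y + u)) ∂μ := by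
  have hvol : volume (ball x₀ r) = volume (ball (0 : Euc N) r) := by
    simpa using setLIntegral_ball_eq_setLIntegral_ball_zero (fun _ => 1) x₀ r
  calc (∫⁻ y, w (x₀ - y) ∂μ) * volume (ball (0 : Euc N) r)
      = ∫⁻ _ in ball x₀ r, ∫⁻ y, w (x₀ - y) ∂μ := by rw [setLIntegral_const, hvol]
    _ ≤ ∫⁻ x in ball x₀ r, ∫⁻ y, w (x - y) ∂μ := lintegral_mono_ae h
    _ = ∫⁻ y, (∫⁻ x in ball x₀ r, w (x - y)) ∂μ :=
        lintegral_lintegral_swap (by fun_prop)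
    _ = ∫⁻ y, (∫⁻ u in ball 0 r, w (x₀ - y + u)) ∂μ := by
        refine lintegral_congr fun y => ?_
        rw [setLIntegral_ball_eq_setLIntegral_ball_zero]
        refine lintegral_congr fun u => ?_
        congr 1; abel

theorem lintegral_mul_add_tsub_le {X : Type*} [MeasurableSpace X] (μ : Measure X)
    [IsProbabilityMeasure μ] {f a : X → ℝ≥0∞} (hf : Measurable f) (ha : Measurable a)
    {c C : ℝ≥0∞} (hc : c ≠ ⊤) (hfin : ∫⁻ x, a x ∂μ ≠ ⊤)
    (hle : ∀ x, c * a x ≤ c * f x + C) (h : ∫⁻ x, f x ∂μ ≤ ∫⁻ x, a x ∂μ) :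
    ∫⁻ x, (c * f x + C - c * a x) ∂μ ≤ C := by
  have hca : ∫⁻ x, c * a x ∂μ = c * ∫⁻ x, a x ∂μ := lintegral_const_mul _ ha
  rw [lintegral_sub (by fun_prop) (by rw [hca]; finiteness) (Eventually.of_forall hle),
    lintegral_add_right _ measurable_const, lintegral_const_mul _ hf, hca]
  simp only [lintegral_const, measure_univ, mul_one]
  rw [tsub_le_iff_left]
  gcongr

/-- under (H1')-(H4), if `x₀` is an a.e.-local minimum of `V_μ = W∗μ`,
then `(Δ⁰W ∗ μ)(x₀) ≥ 0`. -/
theorem statement2 {N : ℕ} (W : Euc N → EReal)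
    (hW0 : ∀ x, 0 ≤ W x) (hWlsc : LowerSemicontinuous W)
    (M : ℝ) (hM : 0 < M)
    (hH3 : ∀ x : Euc N, eint (volume.restrict (ball x 1)) W ≤ ((M : ℝ) : EReal))
    (Cstar : ℝ) (hCstar : 0 < Cstar)
    (hH4 : ∀ x : Euc N, ∀ ε ∈ Ioo (0 : ℝ) 1, approxLap W ε x < ((Cstar : ℝ) : EReal))
    (μ : Measure (Euc N)) (hμ : IsProbabilityMeasure μ) (x₀ : Euc N)
    (hmin : ∃ ε₀ > 0, ∀ᵐ x ∂(volume.restrict (ball x₀ ε₀)), Wconv W μ x₀ ≤ Wconv W μ x) :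
    0 ≤ eint μ (fun y => -negGenLap W (x₀ - y)) := by
  obtain ⟨ε₀, hε₀, hmin⟩ := hmin
  set w : Euc N → ℝ≥0∞ := fun x => (W x).toENNReal with hw_def
  have hWw : W = fun x => (w x : EReal) := funext fun x => (EReal.coe_toENNReal (hW0 x)).symm
  have hw : Measurable w := hWlsc.measurable.ereal_toENNReal
  clear_value w
  subst hWw
  simp only [Wconv, eint_coe_ennreal, EReal.coe_ennreal_le_coe_ennreal_iff] at hmin
  set I : ℝ → Euc N → ℝ≥0∞ := fun r z => ∫⁻ u in ball 0 r, w (z + u) with hI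
  have hImeas : ∀ r, Measurable (I r) := fun r =>
    Measurable.lintegral_prod_right' (f := fun p : Euc N × Euc N => w (p.1 + p.2)) (by fun_prop)
  have hIle : ∀ r ≤ 1, ∀ z, I r z ≤ ENNReal.ofReal M := by
    intro r hr z
    refine (lintegral_mono_set (ball_subset_ball hr)).trans ?_
    have h := hH3 z
    rw [eint_coe_ennreal, setLIntegral_ball_eq_setLIntegral_ball_zero] at h
    rw [← EReal.coe_ennreal_le_coe_ennreal_iff, EReal.coe_ennreal_ofReal, max_eq_left hM.le]
    exact h
  set v : ℝ → ℝ≥0∞ := fun r => volume (ball (0 : Euc N) r) with hv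
  have hv0 : ∀ r, 0 < r → v r ≠ 0 := fun r hr => (measure_ball_pos _ _ hr).ne'
  have hvtop : ∀ r, v r ≠ ⊤ := fun r => measure_ball_lt_top.ne
  set c : ℝ → ℝ := fun r => 2 * (N + 2) / r ^ 2 with hc
  have hcpos : ∀ r, 0 < r → 0 < c r := fun r hr => by simp only [hc]; positivity
  have hLap : ∀ r, 0 < r → ∀ z, approxLap (fun x => (w x : EReal)) r z =
      (c r : EReal) * (((v r)⁻¹ * I r z : ℝ≥0∞) - w z) := fun r hr z => by
    rw [approxLap, ballAvg_coe_ennreal (fun y => w (z + y)) 0 hr]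
  have hafin : ∀ r ∈ Ioo (0 : ℝ) 1, ∀ z, (v r)⁻¹ * I r z ≤ (v r)⁻¹ * ENNReal.ofReal M :=
    fun r hr z => by gcongr; exact hIle r hr.2.le z
  have hatop : ∀ r ∈ Ioo (0 : ℝ) 1, (v r)⁻¹ * ENNReal.ofReal M ≠ ⊤ := fun r hr =>
    ENNReal.mul_ne_top (ENNReal.inv_ne_top.2 (hv0 r hr.1)) ENNReal.ofReal_ne_top
  set K : ℝ≥0∞ := ENNReal.ofReal Cstar with hK
  set g : ℝ → Euc N → ℝ≥0∞ := fun r z =>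
    ENNReal.ofReal (c r) * w z + K - ENNReal.ofReal (c r) * ((v r)⁻¹ * I r z) with hg
  have hgmeas : ∀ r, Measurable (g r) := fun r => by
    have := hImeas r
    simp only [hg]
    fun_prop
  have hgLap : ∀ r ∈ Ioo (0 : ℝ) 1, ∀ z,
      -approxLap (fun x => (w x : EReal)) r z = (g r z : EReal) - Cstar := fun r hr z => by
    have h4 := (hH4 z r hr).le
    rw [hLap r hr.1] at h4 ⊢
    exact neg_mul_sub_eq_coe_tsub (hcpos r hr.1) hCstar.le
      (ne_top_of_le_ne_top (hatop r hr) (hafin r hr z)) h4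
  have hsmall : ∀ r ∈ Ioo (0 : ℝ) 1, r ≤ ε₀ → ∫⁻ y, g r (x₀ - y) ∂μ ≤ K := by
    intro r hr hrε
    have hsub := mul_lintegral_le_lintegral_setLIntegral hw μ x₀
      (ae_mono (Measure.restrict_mono (ball_subset_ball hrε) le_rfl) hmin)
    have hIx : Measurable fun y => I r (x₀ - y) := (hImeas r).comp (by fun_prop)
    refine lintegral_mul_add_tsub_le μ (f := fun y => w (x₀ - y))
      (a := fun y => (v r)⁻¹ * I r (x₀ - y)) (by fun_prop) (by fun_prop)
      ENNReal.ofReal_ne_top ?_ ?_ ?_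
    · refine ne_top_of_le_ne_top (hatop r hr)
        ((lintegral_mono fun y => hafin r hr (x₀ - y)).trans ?_)
      simp
    · intro y
      have h4 := (hH4 (x₀ - y) r hr).le
      rw [hLap r hr.1] at h4
      exact mul_le_mul_add_of_mul_sub_le (hcpos r hr.1) hCstar.le
        (ne_top_of_le_ne_top (hatop r hr) (hafin r hr _)) h4
    · rw [lintegral_const_mul _ hIx, mul_comm, ← div_eq_mul_inv,
        ENNReal.le_div_iff_mul_le (Or.inl (hv0 r hr.1)) (Or.inl (hvtop r))]
      exact hsub
  set G : Euc N → ℝ≥0∞ := fun z => liminf (fun n : ℕ => g (1 / n) z) atTop with hG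
  have hev : ∀ᶠ n : ℕ in atTop, (1 / n : ℝ) ∈ Ioo (0 : ℝ) 1 ∧ (1 / n : ℝ) ≤ ε₀ := by
    have ht := tendsto_one_div_atTop_nhds_zero_nat (𝕜 := ℝ)
    filter_upwards [ht.eventually_lt_const one_pos, ht.eventually_le_const hε₀,
      eventually_gt_atTop 0] with n h1 h2 h3
    exact ⟨⟨by positivity, h1⟩, h2⟩
  have hnegGen : ∀ z, negGenLap (fun x => (w x : EReal)) z = (G z : EReal) - Cstar := by
    intro z
    rw [hG, ← liminf_coe_ennreal_sub, negGenLap]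
    exact liminf_congr (hev.mono fun n hn => hgLap _ hn.1 z)
  have hGmeas : Measurable G := .liminf fun n => hgmeas _
  have hGint : ∫⁻ y, G (x₀ - y) ∂μ ≤ K :=
    (lintegral_liminf_le fun n => (hgmeas _).comp (by fun_prop)).trans
      (liminf_le_of_frequently_le' (hev.mono fun n hn => hsmall _ hn.1 hn.2).frequently)
  simp only [eint, erealPos_eq_toENNReal, neg_neg, hnegGen, toENNReal_neg_coe_sub_coe,
    toENNReal_coe_sub_coe hCstar.le]
  have hbound : ∫⁻ y, (K - G (x₀ - y)) ∂μ ≤ K :=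
    (lintegral_mono fun y => tsub_le_self).trans (by simp)
  have hGx : Measurable fun y => G (x₀ - y) := hGmeas.comp (by fun_prop)
  have hkey : ∫⁻ y, (G (x₀ - y) - K) ∂μ ≤ ∫⁻ y, (K - G (x₀ - y)) ∂μ := by
    have h1 : ∫⁻ y, (G (x₀ - y) - K + K) ∂μ = ∫⁻ y, (G (x₀ - y) + (K - G (x₀ - y))) ∂μ :=
      lintegral_congr fun y => by rw [tsub_add_eq_max, add_tsub_eq_max, max_comm]
    rw [lintegral_add_right _ measurable_const, lintegral_add_left hGx] at h1
    simp only [lintegral_const, measure_univ, mul_one] at h1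
    refine (ENNReal.add_le_add_iff_right (ENNReal.ofReal_ne_top (r := Cstar))).1 ?_
    rw [h1, add_comm]
    gcongr
  rw [EReal.sub_nonneg]
  · exact_mod_cast hkey
  · exact Or.inl (by
      simpa using ne_top_of_le_ne_top (ENNReal.ofReal_ne_top (r := Cstar)) hbound)
  · simp

end
end

section
/- Let W: ℝ^N → (−∞, +∞] satisfy: (H1) W is bounded from below; (H2) W is lower semicontinuous; (H3) there exists M > 0 with ∫_{B(x,1)} W(y) dy ≤ M for all x ∈ ℝ^N; (H4) there exists C* > 0 such that Δ^ε W(x) < C* for all x ∈ ℝ^N and all ε ∈ (0,1). Let μ ∈ P(ℝ^N) be a compactly supported local minimizer of the interaction energy E_W with respect to the topology induced by d_∞. If W is β-repulsive at the origin for some 0 < β < N, then for every part ρ of μ, the Hausdorff dimension of supp(ρ) is greater than or equal to β. -/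
open MeasureTheory Metric Set Filter
open scoped ENNReal NNReal Topology

noncomputable section

/-- The uniform probability measure on the ball `B(0,r)`. -/
def ballUnif (N : ℕ) (r : ℝ) : Measure (Euc N) :=
  ProbabilityTheory.cond volume (ball 0 r)

/-- The average of `w` over the ball `B(z,r)`. -/
def ballMean {N : ℕ} (w : Euc N → ℝ≥0∞) (r : ℝ) (z : Euc N) : ℝ≥0∞ :=
  ∫⁻ u, w (z + u) ∂ballUnif N r

/-- The mutual interaction `∬ w(x-y) dβ(y) dα(x)` for a nonnegative kernel. -/
def crossEnergy {N : ℕ} (w : Euc N → ℝ≥0∞) (α β : Measure (Euc N)) : ℝ≥0∞ :=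
  ∫⁻ x, ∫⁻ y, w (x - y) ∂β ∂α

section Nonneg

variable {N : ℕ}

theorem isProbabilityMeasure_ballUnif {r : ℝ} (hr : 0 < r) :
    IsProbabilityMeasure (ballUnif N r) :=
  ProbabilityTheory.cond_isProbabilityMeasure_of_finite
    (measure_ball_pos volume 0 hr).ne' measure_ball_lt_top.ne

instance (r : ℝ) : IsFiniteMeasure (ballUnif N r) := by
  unfold ballUnif; infer_instance

theorem lintegral_ballUnif (f : Euc N → ℝ≥0∞) (r : ℝ) :
    ∫⁻ u, f u ∂ballUnif N r =
      (volume (ball (0 : Euc N) r))⁻¹ * ∫⁻ u in ball 0 r, f u := by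
  rw [ballUnif, ProbabilityTheory.cond, lintegral_smul_measure, smul_eq_mul]

theorem setLIntegral_ball_translate (w : Euc N → ℝ≥0∞) (r : ℝ) (z : Euc N) :
    ∫⁻ u in ball (0 : Euc N) r, w (z + u) = ∫⁻ y in ball z r, w y := by
  rw [← lintegral_indicator measurableSet_ball, ← lintegral_indicator measurableSet_ball,
    ← lintegral_add_left_eq_self ((ball z r).indicator w) z]
  refine lintegral_congr fun u => ?_
  simp [indicator]

theorem ballMean_neg (w : Euc N → ℝ≥0∞) (r : ℝ) (z : Euc N) :
    ballMean (fun x => w (-x)) r z = ballMean w r (-z) := by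
  unfold ballMean
  rw [lintegral_ballUnif, lintegral_ballUnif, ← lintegral_indicator measurableSet_ball,
    ← lintegral_indicator measurableSet_ball, ← lintegral_neg_eq_self]
  congr 1
  refine lintegral_congr fun u => ?_
  simp [indicator, add_comm]

theorem measurable_ballMean {w : Euc N → ℝ≥0∞} (hw : Measurable w) (r : ℝ) :
    Measurable (ballMean w r) := by
  unfold ballMean
  exact Measurable.lintegral_prod_right' (f := fun p : Euc N × Euc N => w (p.1 + p.2))
    (by fun_prop)

theorem measurable_lintegral_sub {w : Euc N → ℝ≥0∞} (hw : Measurable w) (β : Measure (Euc N))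
    [SFinite β] : Measurable fun x => ∫⁻ y, w (x - y) ∂β :=
  Measurable.lintegral_prod_right' (f := fun p : Euc N × Euc N => w (p.1 - p.2)) (by fun_prop)

theorem crossEnergy_comm {w : Euc N → ℝ≥0∞} (hw : Measurable w) (hs : ∀ z, w (-z) = w z)
    (α β : Measure (Euc N)) [SFinite α] [SFinite β] : crossEnergy w α β = crossEnergy w β α := by
  unfold crossEnergy
  rw [lintegral_lintegral_swap]
  · refine lintegral_congr fun y => lintegral_congr fun x => ?_
    rw [← hs, neg_sub]
  · exact (hw.comp (by fun_prop : Measurable fun p : Euc N × Euc N => p.1 - p.2)).aemeasurable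

theorem crossEnergy_add_left (w : Euc N → ℝ≥0∞) (α α' β : Measure (Euc N)) :
    crossEnergy w (α + α') β = crossEnergy w α β + crossEnergy w α' β := by
  simp [crossEnergy, lintegral_add_measure]

theorem crossEnergy_smul_left (w : Euc N → ℝ≥0∞) (c : ℝ≥0) (α β : Measure (Euc N)) :
    crossEnergy w (c • α) β = c * crossEnergy w α β := by
  change crossEnergy w ((c : ℝ≥0∞) • α) β = _
  simp only [crossEnergy, lintegral_smul_measure, smul_eq_mul]

theorem crossEnergy_mono {w : Euc N → ℝ≥0∞} {α α' β β' : Measure (Euc N)} (h : α ≤ α')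
    (h' : β ≤ β') : crossEnergy w α β ≤ crossEnergy w α' β' :=
  lintegral_mono' h fun _ => lintegral_mono' h' fun _ => le_rfl

theorem crossEnergy_add_smul_self {w : Euc N → ℝ≥0∞} (hw : Measurable w) (hs : ∀ z, w (-z) = w z)
    (α β : Measure (Euc N)) [SFinite α] [SFinite β] (t : ℝ≥0) :
    crossEnergy w (α + t • β) (α + t • β) =
      crossEnergy w α α + t * (2 * crossEnergy w α β + t * crossEnergy w β β) := by
  rw [crossEnergy_add_left, crossEnergy_smul_left, crossEnergy_comm hw hs α, crossEnergy_comm hw hs β,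
    crossEnergy_add_left, crossEnergy_add_left, crossEnergy_smul_left, crossEnergy_smul_left, crossEnergy_comm hw hs β α]
  ring

theorem crossEnergy_conv {w : Euc N → ℝ≥0∞} (hw : Measurable w) (r : ℝ) (α β : Measure (Euc N))
    [SFinite α] [SFinite β] :
    crossEnergy w (α ∗ ballUnif N r) β = ∫⁻ x, ∫⁻ y, ballMean w r (x - y) ∂β ∂α := by
  unfold crossEnergy
  rw [Measure.lintegral_conv (measurable_lintegral_sub hw β)]
  refine lintegral_congr fun x => ?_
  rw [lintegral_lintegral_swap]
  · simp only [ballMean, sub_add_eq_add_sub]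
  · exact (hw.comp (by fun_prop :
      Measurable fun p : Euc N × Euc N => x + p.1 - p.2)).aemeasurable

theorem crossEnergy_conv_lt_top {w : Euc N → ℝ≥0∞} (hw : Measurable w) {r : ℝ} {B : ℝ≥0∞}
    (hB : B ≠ ⊤) (hwB : ∀ z, ballMean w r z ≤ B) (α β : Measure (Euc N))
    [IsFiniteMeasure α] [IsFiniteMeasure β] :
    crossEnergy w (α ∗ ballUnif N r) β < ⊤ := by
  rw [crossEnergy_conv hw]
  calc ∫⁻ x, ∫⁻ y, ballMean w r (x - y) ∂β ∂α
      ≤ ∫⁻ _, ∫⁻ _, B ∂β ∂α := by gcongr; exact hwB _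
    _ = B * β univ * α univ := by simp
    _ < ⊤ := by finiteness

theorem msupp_subset_of_isOpen {X : Type*} [PseudoMetricSpace X] [MeasurableSpace X]
    {μ : Measure X} {U : Set X} (hU : IsOpen U) (h : μ U = 0) : msupp μ ⊆ Uᶜ := by
  intro x hx hxU
  obtain ⟨ε, hε, hsub⟩ := Metric.isOpen_iff.1 hU x hxU
  exact (hx ε hε).ne' (measure_mono_null hsub h)

theorem dInfty_le_of_plan {μ ν : Measure (Euc N)} {π : Measure (Euc N × Euc N)}
    (hπ : π ∈ plans μ ν) {r : ℝ} (h : π {p | r < dist p.1 p.2} = 0) :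
    dInfty μ ν ≤ ENNReal.ofReal r := by
  refine (iInf₂_le π hπ).trans (iSup₂_le fun p hp => ?_)
  have hU : IsOpen {p : Euc N × Euc N | r < dist p.1 p.2} :=
    isOpen_lt continuous_const (by fun_prop)
  have := msupp_subset_of_isOpen hU h hp
  rw [edist_dist]
  exact ENNReal.ofReal_le_ofReal (by simpa using this)

/-- Spreading the mass of `α` over balls of radius `r` moves it by at most `r`. -/
theorem dInfty_add_conv_le {κ α : Measure (Euc N)} [IsFiniteMeasure κ] [IsFiniteMeasure α]
    {r : ℝ} (hr : 0 < r) (hp : IsProbabilityMeasure (κ + α)) :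
    dInfty (κ + α) (κ + α ∗ ballUnif N r) ≤ ENNReal.ofReal r := by
  have := isProbabilityMeasure_ballUnif (N := N) hr
  have hd : Measurable fun x : Euc N => (x, x) := by fun_prop
  have hm : Measurable fun p : Euc N × Euc N => (p.1, p.1 + p.2) := by fun_prop
  have hfst : (κ.map (fun x => (x, x)) +
      (α.prod (ballUnif N r)).map (fun p => (p.1, p.1 + p.2))).map Prod.fst = κ + α := by
    rw [Measure.map_add _ _ measurable_fst, Measure.map_map measurable_fst hd,
      Measure.map_map measurable_fst hm]
    congr 1
    · exact Measure.map_id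
    · exact (Measure.map_fst_prod).trans (by simp)
  have hsnd : (κ.map (fun x => (x, x)) +
      (α.prod (ballUnif N r)).map (fun p => (p.1, p.1 + p.2))).map Prod.snd =
        κ + α ∗ ballUnif N r := by
    rw [Measure.map_add _ _ measurable_snd, Measure.map_map measurable_snd hd,
      Measure.map_map measurable_snd hm]
    congr 1
    exact Measure.map_id
  refine dInfty_le_of_plan (π := κ.map (fun x => (x, x)) +
    (α.prod (ballUnif N r)).map (fun p => (p.1, p.1 + p.2))) ⟨⟨?_⟩, hfst, hsnd⟩ ?_
  · have := congrArg (fun m => m univ) hfst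
    rw [Measure.map_apply measurable_fst .univ, preimage_univ] at this
    rw [this, measure_univ]
  · have hU : MeasurableSet {p : Euc N × Euc N | r < dist p.1 p.2} :=
      (isOpen_lt continuous_const (by fun_prop)).measurableSet
    rw [Measure.add_apply, Measure.map_apply hd hU, Measure.map_apply hm hU]
    have h1 : (fun x : Euc N => (x, x)) ⁻¹' {p | r < dist p.1 p.2} = ∅ := by
      ext x; simp [hr.le]
    have h2 : (fun p : Euc N × Euc N => (p.1, p.1 + p.2)) ⁻¹' {p | r < dist p.1 p.2} ⊆
        univ ×ˢ (ball 0 r)ᶜ := by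
      rintro ⟨x, u⟩ h
      simp at h ⊢
      exact h.le
    rw [h1, measure_empty, zero_add]
    refine measure_mono_null h2 ?_
    rw [Measure.prod_prod]
    have : ballUnif N r (ball 0 r)ᶜ = 0 := by
      rw [ballUnif, ProbabilityTheory.cond_apply measurableSet_ball]
      simp
    simp [this]

/-- The first variation: at a local minimizer, the potential is almost everywhere below
its average over small balls. -/
theorem ae_potential_le_ballMean {w : Euc N → ℝ≥0∞} (hw : Measurable w)
    (hs : ∀ z, w (-z) = w z) {r : ℝ} (hr : 0 < r) {B : ℝ≥0∞} (hB : B ≠ ⊤)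
    (hwB : ∀ z, ballMean w r z ≤ B) {μ : Measure (Euc N)} [IsProbabilityMeasure μ]
    (hmin : ∀ ν : Measure (Euc N), IsProbabilityMeasure ν →
      dInfty μ ν ≤ ENNReal.ofReal r → crossEnergy w μ μ ≤ crossEnergy w ν ν) :
    ∀ᵐ x ∂μ, ∫⁻ y, w (x - y) ∂μ < ⊤ ∧
      ∫⁻ y, w (x - y) ∂μ ≤ ∫⁻ y, ballMean w r (x - y) ∂μ := by
  have := isProbabilityMeasure_ballUnif (N := N) hr
  have hfin : crossEnergy w μ μ < ⊤ := by
    refine (hmin (μ ∗ ballUnif N r) inferInstance ?_).trans_lt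
      (crossEnergy_conv_lt_top hw hB hwB _ _)
    simpa using dInfty_add_conv_le (κ := 0) (α := μ) hr (by simpa)
  have hkey : ∀ A : Set (Euc N), MeasurableSet A →
      crossEnergy w (μ.restrict A) μ ≤ crossEnergy w (μ.restrict A ∗ ballUnif N r) μ := by
    intro A hA
    set α := μ.restrict A with hα
    set σ := α ∗ ballUnif N r with hσ
    have hαμ : α ≤ μ := Measure.restrict_le_self
    have hαα : crossEnergy w α α < ⊤ := (crossEnergy_mono hαμ hαμ).trans_lt hfin
    have hσσ : crossEnergy w σ σ < ⊤ := crossEnergy_conv_lt_top hw hB hwB _ _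
    have hvar : ∀ t : ℝ≥0, 0 < t → t ≤ 1 →
        2 * crossEnergy w μ α ≤ 2 * crossEnergy w μ σ + t * (crossEnergy w σ σ + crossEnergy w α α) := by
      intro t ht ht1
      set κ : Measure (Euc N) := μ.restrict Aᶜ + (1 - t) • α with hκ
      have hμκ : κ + t • α = μ := by
        rw [hκ, add_assoc, ← add_smul, tsub_add_cancel_of_le ht1, one_smul, hα,
          add_comm, Measure.restrict_add_restrict_compl hA]
      have hκμ : κ ≤ μ := by
        conv_rhs => rw [← hμκ]
        exact Measure.le_add_right le_rfl
      have : IsFiniteMeasure κ := isFiniteMeasure_of_le μ hκμ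
      have hσt : (t • α) ∗ ballUnif N r = t • σ := by
        rw [hσ]
        exact Measure.conv_smul_left α (ballUnif N r) t
      have hpν : IsProbabilityMeasure (κ + t • σ) := by
        constructor
        have h1 : κ univ + t • α univ = 1 := by
          have : (κ + t • α) univ = 1 := by rw [hμκ]; exact measure_univ
          simpa using this
        have h2 : σ univ = α univ := by
          have := Measure.lintegral_conv (μ := α) (ν := ballUnif N r)
            (f := fun _ => 1) measurable_const
          simpa using this
        simpa [h2] using h1
      have hd : dInfty μ (κ + t • σ) ≤ ENNReal.ofReal r := by
        rw [← hσt]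
        conv_lhs => rw [← hμκ]
        exact dInfty_add_conv_le hr (by rw [hμκ]; infer_instance)
      have h := hmin _ hpν hd
      conv_lhs at h => rw [← hμκ]
      rw [crossEnergy_add_smul_self hw hs κ α, crossEnergy_add_smul_self hw hs κ σ] at h
      have hκfin : crossEnergy w κ κ ≠ ⊤ := ((crossEnergy_mono hκμ hκμ).trans_lt hfin).ne
      have h' := (ENNReal.mul_le_mul_iff_right (by simpa using ht.ne') ENNReal.coe_ne_top).1
        ((ENNReal.add_le_add_iff_left hκfin).1 h)
      have e : crossEnergy w μ α = crossEnergy w κ α + t * crossEnergy w α α := by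
        conv_lhs => rw [← hμκ]
        rw [crossEnergy_add_left, crossEnergy_smul_left]
      calc 2 * crossEnergy w μ α
          = (2 * crossEnergy w κ α + t * crossEnergy w α α) + t * crossEnergy w α α := by rw [e]; ring
        _ ≤ (2 * crossEnergy w κ σ + t * crossEnergy w σ σ) + t * crossEnergy w α α := by gcongr
        _ ≤ (2 * crossEnergy w μ σ + t * crossEnergy w σ σ) + t * crossEnergy w α α := by
            gcongr; exact crossEnergy_mono hκμ le_rfl
        _ = _ := by ring
    rw [crossEnergy_comm hw hs α, crossEnergy_comm hw hs σ]
    have hD : crossEnergy w σ σ + crossEnergy w α α ≠ ⊤ := by finiteness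
    have h2 : 2 * crossEnergy w μ α ≤ 2 * crossEnergy w μ σ := by
      have hlim : Tendsto (fun t : ℝ≥0 =>
          2 * crossEnergy w μ σ + t * (crossEnergy w σ σ + crossEnergy w α α)) (𝓝[>] 0)
          (𝓝 (2 * crossEnergy w μ σ + (0 : ℝ≥0) * (crossEnergy w σ σ + crossEnergy w α α))) := by
        refine Tendsto.const_add _ (ENNReal.Tendsto.mul_const ?_ (Or.inr hD))
        exact (ENNReal.continuous_coe.tendsto 0).mono_left nhdsWithin_le_nhds
      simp only [ENNReal.coe_zero, zero_mul, add_zero] at hlim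
      refine ge_of_tendsto hlim ?_
      filter_upwards [Ioc_mem_nhdsGT (zero_lt_one' ℝ≥0)] with t ht
      exact hvar t ht.1 ht.2
    exact (ENNReal.mul_le_mul_iff_right (by simp) (by simp)).1 h2
  have hmeas := measurable_lintegral_sub hw μ
  have h1 : ∀ᵐ x ∂μ, ∫⁻ y, w (x - y) ∂μ < ⊤ := ae_lt_top hmeas hfin.ne
  have h2 := ae_le_of_forall_setLIntegral_le_of_sigmaFinite hmeas
    (g := fun x => ∫⁻ y, ballMean w r (x - y) ∂μ) (fun A hA _ => by
      rw [← crossEnergy_conv hw r (μ.restrict A) μ]; exact hkey A hA)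
  filter_upwards [h1, h2] with x hx1 hx2 using ⟨hx1, hx2⟩

end Nonneg

/-- Integrating the repulsion bound against `μ` (Fatou) controls the mass of small balls. -/
theorem mul_measure_ball_le {N : ℕ} {w : Euc N → ℝ≥0∞} (hw : Measurable w)
    {μ : Measure (Euc N)} [IsProbabilityMeasure μ] {Λ b : ℝ≥0∞} (hΛ : Λ ≠ ⊤) {k : ℕ → ℝ≥0∞}
    (hk : ∀ n, k n ≠ ⊤) {r : ℕ → ℝ} {x : Euc N} {s : ℝ}
    (hfin : ∀ᶠ n in atTop, ∀ z, ballMean w (r n) z ≠ ⊤)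
    (hsub : ∀ᶠ n in atTop, ∀ z, k n * ballMean w (r n) z ≤ k n * w z + Λ)
    (hx : ∀ᶠ n in atTop, ∫⁻ y, w (x - y) ∂μ < ⊤ ∧
      ∫⁻ y, w (x - y) ∂μ ≤ ∫⁻ y, ballMean w (r n) (x - y) ∂μ)
    (hrep : ∀ z, ‖z‖ < s → ∀ᶠ n in atTop, k n * ballMean w (r n) z + b ≤ k n * w z) :
    b * μ (ball x s) ≤ Λ := by
  set f : ℕ → Euc N → ℝ≥0∞ := fun n y =>
    (k n * w (x - y) + Λ) - k n * ballMean w (r n) (x - y) with hf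
  have hmw : Measurable fun y => w (x - y) := by fun_prop
  have hma : ∀ n, Measurable fun y => ballMean w (r n) (x - y) := fun n =>
    (measurable_ballMean hw (r n)).comp (by fun_prop)
  have hfm : ∀ n, Measurable (f n) := fun n =>
    ((hmw.const_mul _).add_const _).sub ((hma n).const_mul _)
  have hint : ∀ᶠ n in atTop, ∫⁻ y, f n y ∂μ ≤ Λ := by
    filter_upwards [hsub, hx] with n hn hxn
    have hI : ∫⁻ y, (k n * w (x - y) + Λ) ∂μ = k n * ∫⁻ y, w (x - y) ∂μ + Λ := by
      rw [lintegral_add_right _ measurable_const, lintegral_const_mul _ hmw]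
      simp
    have hle : ∫⁻ y, k n * ballMean w (r n) (x - y) ∂μ ≤ k n * ∫⁻ y, w (x - y) ∂μ + Λ :=
      hI ▸ lintegral_mono fun y => hn _
    have hne : ∫⁻ y, k n * ballMean w (r n) (x - y) ∂μ ≠ ⊤ :=
      (hle.trans_lt (ENNReal.add_lt_top.2
        ⟨ENNReal.mul_lt_top (hk n).lt_top hxn.1, hΛ.lt_top⟩)).ne
    rw [hf, lintegral_sub ((hma n).const_mul _) hne (ae_of_all _ fun y => hn _), hI,
      tsub_le_iff_left, lintegral_const_mul _ (hma n)]
    exact add_le_add_left (mul_le_mul_right hxn.2 (k n)) Λ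
  have hlow : ∀ y ∈ ball x s, b ≤ liminf (fun n => f n y) atTop := by
    intro y hy
    have hy' : ‖x - y‖ < s := by rwa [← dist_eq_norm, dist_comm]
    refine le_liminf_of_le (by isBoundedDefault) ?_
    filter_upwards [hrep _ hy', hfin] with n hn hfn
    exact ENNReal.le_sub_of_add_le_left (ENNReal.mul_ne_top (hk n) (hfn _))
      (hn.trans le_self_add)
  calc b * μ (ball x s) = ∫⁻ _ in ball x s, b ∂μ := by simp
    _ ≤ ∫⁻ y in ball x s, liminf (fun n => f n y) atTop ∂μ :=
        setLIntegral_mono' measurableSet_ball hlow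
    _ ≤ ∫⁻ y, liminf (fun n => f n y) atTop ∂μ := setLIntegral_le_lintegral _ _
    _ ≤ liminf (fun n => ∫⁻ y, f n y ∂μ) atTop := lintegral_liminf_le hfm
    _ ≤ Λ := liminf_le_of_frequently_le' hint.frequently

/-- The mass distribution principle: a measure whose balls satisfy `μ(B(x,s)) ≤ K s^β` only
charges sets of Hausdorff dimension at least `β`. -/
theorem le_dimH_of_measure_ball_le {X : Type*} [MetricSpace X] [MeasurableSpace X]
    [BorelSpace X] {μ : Measure X} {K : ℝ≥0∞} (hK : K ≠ ⊤) {β s₀ : ℝ} (hβ : 0 < β)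
    (hs₀ : 0 < s₀)
    (h : ∀ᵐ x ∂μ, ∀ s ∈ Ioo 0 s₀, μ (ball x s) ≤ K * ENNReal.ofReal s ^ β)
    {S : Set X} (hS : μ S ≠ 0) : ENNReal.ofReal β ≤ dimH S := by
  by_contra! hlt
  have hzero : μH[β] S = 0 := by
    have := hausdorffMeasure_of_dimH_lt (d := β.toNNReal) hlt
    rwa [Real.coe_toNNReal _ hβ.le] at this
  obtain ⟨G, hGsub, hG, hGc⟩ : ∃ G ⊆ {x | ∀ s ∈ Ioo 0 s₀, μ (ball x s) ≤
      K * ENNReal.ofReal s ^ β}, MeasurableSet G ∧ μ Gᶜ = 0 := by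
    obtain ⟨t, ht, htm, ht0⟩ := exists_measurable_superset_of_null (mem_ae_iff.1 h)
    exact ⟨tᶜ, compl_subset_comm.1 ht, htm.compl, by rwa [compl_compl]⟩
  have hbound : ∀ s : Set X, ediam s ≤ ENNReal.ofReal (s₀ / 2) →
      μ.restrict G s ≤ (K + 1) * ediam s ^ β := by
    intro s hs
    rw [Measure.restrict_apply' hG]
    rcases (s ∩ G).eq_empty_or_nonempty with he | ⟨x, hxs, hxG⟩
    · simp [he]
    have hfin : ediam s ≠ ⊤ := (hs.trans_lt ENNReal.ofReal_lt_top).ne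
    set d := (ediam s).toReal with hd
    have hde : ediam s = ENNReal.ofReal d := (ENNReal.ofReal_toReal hfin).symm
    have hd0 : 0 ≤ d := ENNReal.toReal_nonneg
    have hds : d < s₀ := by
      have := (ENNReal.ofReal_le_ofReal_iff (by positivity)).1 (hde ▸ hs)
      linarith
    have hlim : Tendsto (fun t : ℝ => (K + 1) * ENNReal.ofReal t ^ β) (𝓝[>] d)
        (𝓝 ((K + 1) * ENNReal.ofReal d ^ β)) := by
      refine ENNReal.Tendsto.const_mul ?_ (Or.inr (by finiteness))
      refine ((ENNReal.continuous_rpow_const.comp ENNReal.continuous_ofReal).tendsto d).mono_left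
        nhdsWithin_le_nhds
    rw [hde]
    refine ge_of_tendsto hlim ?_
    filter_upwards [Ioo_mem_nhdsGT hds] with t ht
    have hsub : s ∩ G ⊆ ball x t := by
      rintro y ⟨hys, -⟩
      have := edist_le_ediam_of_mem hys hxs
      rw [hde, edist_dist, ENNReal.ofReal_le_ofReal_iff hd0] at this
      exact this.trans_lt ht.1
    calc μ (s ∩ G) ≤ μ (ball x t) := measure_mono hsub
      _ ≤ K * ENNReal.ofReal t ^ β := hGsub hxG t ⟨hd0.trans_lt ht.1, ht.2⟩
      _ ≤ (K + 1) * ENNReal.ofReal t ^ β := by gcongr; exact le_self_add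
  have hK1 : K + 1 ≠ ⊤ := by finiteness
  have hle : (K + 1)⁻¹ • μ.restrict G ≤ μH[β] := by
    refine Measure.le_hausdorffMeasure β _ (ENNReal.ofReal (s₀ / 2)) (by simpa) fun s hs => ?_
    rw [Measure.smul_apply, smul_eq_mul, ENNReal.inv_mul_le_iff (by simp) hK1]
    exact hbound s hs
  have h0 : (K + 1)⁻¹ * μ (S ∩ G) = 0 := by
    have := (hle S).trans_eq hzero
    simpa [Measure.restrict_apply' hG, hK1] using this
  have h1 : μ (S ∩ G) = 0 := by simpa [hK1] using h0
  refine hS (measure_mono_null ?_ (measure_union_null h1 hGc))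
  intro y hy
  by_cases hyG : y ∈ G
  · exact Or.inl ⟨hy, hyG⟩
  · exact Or.inr hyG

theorem measure_compl_msupp {X : Type*} [PseudoMetricSpace X] [SecondCountableTopology X]
    [MeasurableSpace X] (ρ : Measure X) : ρ (msupp ρ)ᶜ = 0 := by
  refine measure_null_of_locally_null _ fun x hx => ?_
  simp only [msupp, mem_compl_iff, mem_ofPred_eq, not_forall, not_lt, nonpos_iff_eq_zero] at hx
  obtain ⟨ε, hε, h0⟩ := hx
  exact ⟨ball x ε, mem_nhdsWithin_of_mem_nhds (ball_mem_nhds x hε), h0⟩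

theorem erealPos_add_coe {d : ℝ≥0} {x : EReal} (hx : (-(d : ℝ) : ℝ) ≤ x) :
    erealPos x + d = (x + (d : ℝ)).toENNReal + erealPos (-x) := by
  induction x with
  | bot => simp at hx
  | top => simp [erealPos]
  | coe x =>
    have hx' : -(d : ℝ) ≤ x := by exact_mod_cast hx
    have e1 : erealPos (x : EReal) = ENNReal.ofReal x := by simp [erealPos]
    have e2 : erealPos (-(x : EReal)) = ENNReal.ofReal (-x) := by
      rw [← EReal.coe_neg]; simp [erealPos]
    rw [e1, e2, ← EReal.coe_add, EReal.real_coe_toENNReal, ← ENNReal.ofReal_coe_nnreal]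
    rcases le_total 0 x with h | h
    · rw [ENNReal.ofReal_of_nonpos (p := -x) (by linarith), add_zero,
        ENNReal.ofReal_add h d.coe_nonneg]
    · rw [ENNReal.ofReal_of_nonpos (p := x) h, zero_add,
        ← ENNReal.ofReal_add (by linarith) (by linarith)]
      ring_nf

theorem erealPos_neg_le {d : ℝ≥0} {x : EReal} (hx : (-(d : ℝ) : ℝ) ≤ x) :
    erealPos (-x) ≤ d := by
  induction x with
  | bot => simp at hx
  | top => simp [erealPos]
  | coe x =>
    have hx' : -(d : ℝ) ≤ x := by exact_mod_cast hx
    rw [← EReal.coe_neg]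
    simp only [erealPos, EReal.coe_ne_top, if_false, EReal.toReal_coe]
    rw [← ENNReal.ofReal_coe_nnreal]
    exact ENNReal.ofReal_le_ofReal (by linarith)

/-- The extended integral of a function bounded below by `-d`, as the integral of the
nonnegative function `f + d` minus `d` times the total mass. -/
theorem eint_eq_lintegral_sub {X : Type*} [MeasurableSpace X] (m : Measure X)
    [IsFiniteMeasure m] {f : X → EReal} (hf : Measurable f) {d : ℝ≥0}
    (hd : ∀ x, ((-(d : ℝ) : ℝ) : EReal) ≤ f x) :
    eint m f = ((∫⁻ x, (f x + (d : ℝ)).toENNReal ∂m : ℝ≥0∞) : EReal) -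
      ((d * m univ).toReal : ℝ) := by
  have hneg : ∫⁻ x, erealPos (-f x) ∂m ≤ d * m univ := by
    rw [← lintegral_const]
    exact lintegral_mono fun x => erealPos_neg_le (hd x)
  have hmeas : Measurable fun x => (f x + (d : ℝ)).toENNReal :=
    (hf.add_const _).ereal_toENNReal
  have hsum : ∫⁻ x, erealPos (f x) ∂m + d * m univ =
      ∫⁻ x, (f x + (d : ℝ)).toENNReal ∂m + ∫⁻ x, erealPos (-f x) ∂m := by
    rw [← lintegral_const, ← lintegral_add_right _ measurable_const,
      ← lintegral_add_left hmeas]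
    exact lintegral_congr fun x => erealPos_add_coe (hd x)
  have hdm : d * m univ ≠ ⊤ := by finiteness
  have hn : ∫⁻ x, erealPos (-f x) ∂m ≠ ⊤ := (hneg.trans_lt hdm.lt_top).ne
  rw [eint]
  generalize ∫⁻ x, erealPos (f x) ∂m = p at *
  generalize ∫⁻ x, erealPos (-f x) ∂m = q at *
  generalize ∫⁻ x, (f x + (d : ℝ)).toENNReal ∂m = a at *
  generalize d * m univ = e at *
  lift q to ℝ≥0 using hn
  lift e to ℝ≥0 using hdm
  induction p with
  | top =>
    have : a = ⊤ := by simpa using hsum.symm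
    subst this
    simp
  | coe p =>
    have ha : a ≠ ⊤ := by rintro rfl; simp at hsum
    lift a to ℝ≥0 using ha
    have h : (p : ℝ) + e = a + q := by exact_mod_cast hsum
    have : ((p : ℝ) - q : ℝ) = (a : ℝ) - e := by linarith
    simp only [ENNReal.coe_toReal, EReal.coe_nnreal_eq_coe_real]
    exact_mod_cast this

section Kernel

variable {N : ℕ} {W : Euc N → EReal} {d : ℝ≥0}

/-- The nonnegative kernel `W + d`. -/
def shiftKernel (W : Euc N → EReal) (d : ℝ≥0) (x : Euc N) : ℝ≥0∞ :=
  (W x + (d : ℝ)).toENNReal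

theorem measurable_shiftKernel (hW : Measurable W) : Measurable (shiftKernel W d) :=
  (hW.add_const _).ereal_toENNReal

theorem shiftKernel_eq_top_iff (x : Euc N) : shiftKernel W d x = ⊤ ↔ W x = ⊤ := by
  rw [shiftKernel, EReal.toENNReal_eq_top_iff]
  induction W x with
  | bot => simp
  | top => simp
  | coe y => rw [← EReal.coe_add]; simp only [EReal.coe_ne_top]

theorem eq_toReal_shiftKernel (hd : ∀ x, ((-(d : ℝ) : ℝ) : EReal) ≤ W x) {x : Euc N}
    (hx : shiftKernel W d x ≠ ⊤) :
    W x = (((shiftKernel W d x).toReal - d : ℝ) : EReal) := by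
  have hne := mt (shiftKernel_eq_top_iff (d := d) x).2 hx
  have h := hd x
  rw [shiftKernel]
  generalize W x = y at *
  induction y with
  | bot => simp at h
  | top => simp at hne
  | coe y =>
    have h' : -(d : ℝ) ≤ y := by exact_mod_cast h
    rw [← EReal.coe_add, EReal.real_coe_toENNReal, ENNReal.toReal_ofReal (by linarith)]
    simp

theorem crossEnergy_shiftKernel_le (hW : Measurable W)
    (hd : ∀ x, ((-(d : ℝ) : ℝ) : EReal) ≤ W x) {μ ν : Measure (Euc N)}
    [IsProbabilityMeasure μ] [IsProbabilityMeasure ν]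
    (h : interEnergy W μ ≤ interEnergy W ν) :
    crossEnergy (shiftKernel W d) μ μ ≤ crossEnergy (shiftKernel W d) ν ν := by
  have key : ∀ ν : Measure (Euc N), IsProbabilityMeasure ν → interEnergy W ν =
      ((2⁻¹ : ℝ) : EReal) *
        (((crossEnergy (shiftKernel W d) ν ν : ℝ≥0∞) : EReal) - ((d : ℝ) : EReal)) := by
    intro ν _
    have hm : Measurable fun p : Euc N × Euc N => p.1 - p.2 := by fun_prop
    rw [interEnergy, Bform, eint_eq_lintegral_sub (ν.prod ν)
      (f := fun p => W (p.1 - p.2)) (hW.comp hm) (fun p => hd _)]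
    have := lintegral_prod (μ := ν) (ν := ν) (fun p => shiftKernel W d (p.1 - p.2))
      ((measurable_shiftKernel hW).comp hm).aemeasurable
    simp only [shiftKernel] at this
    simp [this, crossEnergy, shiftKernel]
  rw [key μ inferInstance, key ν inferInstance] at h
  generalize crossEnergy (shiftKernel W d) μ μ = a at *
  generalize crossEnergy (shiftKernel W d) ν ν = b at *
  induction b with
  | top => exact le_top
  | coe b =>
    rw [EReal.coe_nnreal_eq_coe_real, ← EReal.coe_sub, ← EReal.coe_mul] at h
    induction a with
    | top =>
      rw [EReal.coe_ennreal_top, EReal.top_sub_coe, EReal.coe_mul_top_of_pos (by norm_num),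
        top_le_iff] at h
      exact absurd h (EReal.coe_ne_top _)
    | coe a =>
      rw [EReal.coe_nnreal_eq_coe_real, ← EReal.coe_sub, ← EReal.coe_mul,
        EReal.coe_le_coe_iff] at h
      have : (a : ℝ) ≤ b := by linarith
      exact_mod_cast this

theorem approxLap_eq (hW : Measurable W) (hd : ∀ x, ((-(d : ℝ) : ℝ) : EReal) ≤ W x)
    {ε : ℝ} (hε : 0 < ε) {x : Euc N} (ha : ballMean (shiftKernel W d) ε x ≠ ⊤) :
    approxLap W ε x = ((2 * (N + 2) / ε ^ 2 : ℝ) : EReal) *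
      ((((ballMean (shiftKernel W d) ε x).toReal - d : ℝ) : EReal) - W x) := by
  rw [approxLap, ballAvg]
  congr 2
  have hv0 := (measure_ball_pos volume (0 : Euc N) hε).ne'
  have hvt : volume (ball (0 : Euc N) ε) ≠ ⊤ := measure_ball_lt_top.ne
  have : IsFiniteMeasure (volume.restrict (ball (0 : Euc N) ε)) :=
    ⟨by simpa using hvt.lt_top⟩
  rw [eint_eq_lintegral_sub _ (f := fun y => W (x + y))
    (hW.comp (measurable_const_add x)) (fun y => hd _)]
  have e : ballMean (shiftKernel W d) ε x = (volume (ball (0 : Euc N) ε))⁻¹ *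
      ∫⁻ y in ball (0 : Euc N) ε, (W (x + y) + (d : ℝ)).toENNReal := lintegral_ballUnif _ _
  rw [e] at ha ⊢
  simp only [Measure.restrict_apply_univ]
  generalize volume (ball (0 : Euc N) ε) = v at *
  generalize ∫⁻ y in ball (0 : Euc N) ε, (W (x + y) + (d : ℝ)).toENNReal = I at *
  have hI : I ≠ ⊤ := by
    rintro rfl
    exact ha (ENNReal.mul_top (by simpa using hvt))
  lift I to ℝ≥0 using hI
  lift v to ℝ≥0 using hvt
  have hv : (v : ℝ) ≠ 0 := by simpa using hv0
  rw [EReal.coe_nnreal_eq_coe_real, ← EReal.coe_sub, ← EReal.coe_mul]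
  congr 1
  simp only [ENNReal.toReal_mul, ENNReal.toReal_inv, ENNReal.coe_toReal]
  field_simp

theorem mul_ballMean_le_of_approxLap_lt (hW : Measurable W)
    (hd : ∀ x, ((-(d : ℝ) : ℝ) : EReal) ≤ W x) {ε : ℝ} (hε : 0 < ε) {x : Euc N}
    (ha : ballMean (shiftKernel W d) ε x ≠ ⊤) {C : ℝ} (hC : 0 ≤ C)
    (h : approxLap W ε x < (C : EReal)) :
    ENNReal.ofReal (2 * (N + 2) / ε ^ 2) * ballMean (shiftKernel W d) ε x ≤
      ENNReal.ofReal (2 * (N + 2) / ε ^ 2) * shiftKernel W d x + ENNReal.ofReal C := by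
  have hk : 0 < 2 * ((N : ℝ) + 2) / ε ^ 2 := by positivity
  rw [approxLap_eq hW hd hε ha] at h
  by_cases hw : shiftKernel W d x = ⊤
  · rw [hw, ENNReal.mul_top (by simpa using hk), top_add]
    exact le_top
  rw [eq_toReal_shiftKernel hd hw, ← EReal.coe_sub, ← EReal.coe_mul, EReal.coe_lt_coe_iff] at h
  generalize 2 * ((N : ℝ) + 2) / ε ^ 2 = k at *
  lift shiftKernel W d x to ℝ≥0 using hw with w
  lift ballMean (shiftKernel W d) ε x to ℝ≥0 using ha with a
  simp only [ENNReal.coe_toReal] at h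
  rw [← ENNReal.ofReal_coe_nnreal, ← ENNReal.ofReal_coe_nnreal, ← ENNReal.ofReal_mul hk.le,
    ← ENNReal.ofReal_mul hk.le, ← ENNReal.ofReal_add (by positivity) hC]
  exact ENNReal.ofReal_le_ofReal (by linarith)

theorem mul_ballMean_add_le_of_lt_neg_approxLap (hW : Measurable W)
    (hd : ∀ x, ((-(d : ℝ) : ℝ) : EReal) ≤ W x) {ε : ℝ} (hε : 0 < ε) {x : Euc N}
    (ha : ballMean (shiftKernel W d) ε x ≠ ⊤) {b : ℝ} (hb : 0 ≤ b)
    (h : (b : EReal) < -approxLap W ε x) :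
    ENNReal.ofReal (2 * (N + 2) / ε ^ 2) * ballMean (shiftKernel W d) ε x + ENNReal.ofReal b ≤
      ENNReal.ofReal (2 * (N + 2) / ε ^ 2) * shiftKernel W d x := by
  have hk : 0 < 2 * ((N : ℝ) + 2) / ε ^ 2 := by positivity
  rw [approxLap_eq hW hd hε ha] at h
  by_cases hw : shiftKernel W d x = ⊤
  · rw [hw, ENNReal.mul_top (by simpa using hk)]
    exact le_top
  rw [eq_toReal_shiftKernel hd hw, ← EReal.coe_sub, ← EReal.coe_mul, ← EReal.coe_neg,
    EReal.coe_lt_coe_iff] at h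
  generalize 2 * ((N : ℝ) + 2) / ε ^ 2 = k at *
  lift shiftKernel W d x to ℝ≥0 using hw with w
  lift ballMean (shiftKernel W d) ε x to ℝ≥0 using ha with a
  simp only [ENNReal.coe_toReal] at h
  rw [← ENNReal.ofReal_coe_nnreal, ← ENNReal.ofReal_coe_nnreal, ← ENNReal.ofReal_mul hk.le,
    ← ENNReal.ofReal_mul hk.le, ← ENNReal.ofReal_add (by positivity) hb]
  exact ENNReal.ofReal_le_ofReal (by linarith)

theorem ballMean_le_of_eint_le (hW : Measurable W)
    (hd : ∀ x, ((-(d : ℝ) : ℝ) : EReal) ≤ W x) {M : ℝ}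
    (hM : ∀ x : Euc N, eint (volume.restrict (ball x 1)) W ≤ (M : EReal)) {r : ℝ}
    (hr : 0 < r) (hr1 : r ≤ 1) :
    ∃ B : ℝ≥0∞, B ≠ ⊤ ∧ ∀ z, ballMean (shiftKernel W d) r z ≤ B := by
  set v := volume (ball (0 : Euc N) 1) with hv
  have hvt : v ≠ ⊤ := measure_ball_lt_top.ne
  have hint : ∀ x, ∫⁻ y in ball x 1, shiftKernel W d y ≤ ENNReal.ofReal (M + (d * v).toReal) := by
    intro x
    have : IsFiniteMeasure (volume.restrict (ball x 1)) :=
      ⟨by simpa using measure_ball_lt_top⟩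
    have h := hM x
    rw [eint_eq_lintegral_sub _ hW hd, Measure.restrict_apply_univ,
      Measure.addHaar_ball_center, ← hv] at h
    change ((∫⁻ y in ball x 1, shiftKernel W d y : ℝ≥0∞) : EReal) - _ ≤ _ at h
    generalize ∫⁻ y in ball x 1, shiftKernel W d y = I at *
    induction I with
    | top => rw [EReal.coe_ennreal_top, EReal.top_sub_coe] at h; simp at h
    | coe I =>
      rw [EReal.coe_nnreal_eq_coe_real, ← EReal.coe_sub, EReal.coe_le_coe_iff] at h
      rw [← ENNReal.ofReal_coe_nnreal]
      exact ENNReal.ofReal_le_ofReal (by linarith)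
  refine ⟨(volume (ball (0 : Euc N) r))⁻¹ * ENNReal.ofReal (M + (d * v).toReal),
    ENNReal.mul_ne_top (ENNReal.inv_ne_top.2 (measure_ball_pos volume 0 hr).ne')
      ENNReal.ofReal_ne_top, fun z => ?_⟩
  rw [ballMean, lintegral_ballUnif, setLIntegral_ball_translate]
  gcongr
  exact (lintegral_mono_set (ball_subset_ball hr1)).trans (hint z)

end Kernel

section Symmetrize

variable {N : ℕ}

/-- Twice the even part of a kernel. -/
def symmKernel (w : Euc N → ℝ≥0∞) (z : Euc N) : ℝ≥0∞ := w z + w (-z)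

theorem measurable_symmKernel {w : Euc N → ℝ≥0∞} (hw : Measurable w) :
    Measurable (symmKernel w) :=
  hw.add (hw.comp measurable_neg)

theorem symmKernel_neg (w : Euc N → ℝ≥0∞) (z : Euc N) : symmKernel w (-z) = symmKernel w z := by
  simp [symmKernel, add_comm]

theorem ballMean_symmKernel {w : Euc N → ℝ≥0∞} (hw : Measurable w) (r : ℝ) (z : Euc N) :
    ballMean (symmKernel w) r z = ballMean w r z + ballMean w r (-z) := by
  rw [← ballMean_neg]
  unfold ballMean symmKernel
  exact lintegral_add_left (hw.comp (measurable_const_add z)) _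

theorem crossEnergy_symmKernel {w : Euc N → ℝ≥0∞} (hw : Measurable w) (μ : Measure (Euc N))
    [SFinite μ] : crossEnergy (symmKernel w) μ μ = 2 * crossEnergy w μ μ := by
  have h : ∫⁻ x, ∫⁻ y, w (-(x - y)) ∂μ ∂μ = crossEnergy w μ μ := by
    simp only [neg_sub]
    exact lintegral_lintegral_swap
      (hw.comp (by fun_prop : Measurable fun p : Euc N × Euc N => p.2 - p.1)).aemeasurable
  rw [two_mul]
  nth_rw 2 [← h]
  unfold crossEnergy symmKernel
  rw [← lintegral_add_left (measurable_lintegral_sub hw μ)]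
  refine lintegral_congr fun x => lintegral_add_left ?_ _
  fun_prop

end Symmetrize

/-- A local minimizer of a `β`-repulsive energy gives mass at most `K s^β` to the ball `B(x,s)`,
for almost every `x`. -/
theorem exists_measure_ball_le {N : ℕ} {W : Euc N → EReal}
    (hH1 : ∃ c : ℝ, ∀ x, ((c : ℝ) : EReal) ≤ W x)
    (hW : Measurable W)
    (hH3 : ∃ M : ℝ, ∀ x : Euc N,
      eint (volume.restrict (ball x 1)) W ≤ ((M : ℝ) : EReal))
    (hH4 : ∃ Cstar : ℝ, 0 < Cstar ∧ ∀ x : Euc N, ∀ ε ∈ Ioo (0 : ℝ) 1,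
      approxLap W ε x < ((Cstar : ℝ) : EReal))
    {μ : Measure (Euc N)} [IsProbabilityMeasure μ] (hmin : IsLocalMinEnergy W μ)
    {β : ℝ} (hβ : 0 < β) (hrep : IsBetaRepulsive W β) :
    ∃ K : ℝ≥0∞, K ≠ ⊤ ∧ ∃ s₀ : ℝ, 0 < s₀ ∧
      ∀ᵐ x ∂μ, ∀ s ∈ Ioo 0 s₀, μ (ball x s) ≤ K * ENNReal.ofReal s ^ β := by
  obtain ⟨c, hc⟩ := hH1
  obtain ⟨M, hM⟩ := hH3
  obtain ⟨L, hL0, hL⟩ := hH4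
  obtain ⟨⟨s₀, hs₀, C, hC, hCrep⟩, h0rep⟩ := hrep
  obtain ⟨δ, hδ, hδmin⟩ := hmin
  set d : ℝ≥0 := (-c).toNNReal
  have hd : ∀ x, ((-(d : ℝ) : ℝ) : EReal) ≤ W x := fun x =>
    (EReal.coe_le_coe_iff.2 (neg_le.1 (Real.le_coe_toNNReal (-c)))).trans (hc x)
  set w := shiftKernel W d
  have hw : Measurable w := measurable_shiftKernel hW
  have hws := measurable_symmKernel hw
  set r : ℕ → ℝ := fun n => 1 / n with hr
  have hr0 : Tendsto r atTop (𝓝 0) := tendsto_one_div_atTop_nhds_zero_nat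
  have hrIoo : ∀ᶠ n in atTop, r n ∈ Ioo (0 : ℝ) 1 := by
    filter_upwards [eventually_gt_atTop 0, hr0.eventually_lt_const zero_lt_one] with n hn h1
    exact ⟨by simp only [hr]; positivity, h1⟩
  have hrδ : ∀ᶠ n in atTop, ENNReal.ofReal (r n) < δ := by
    have : Tendsto (fun n => ENNReal.ofReal (r n)) atTop (𝓝 0) := by
      simpa using ENNReal.tendsto_ofReal hr0
    exact this.eventually_lt_const hδ
  have hBex : ∀ n, r n ∈ Ioo (0 : ℝ) 1 → ∃ B : ℝ≥0∞, B ≠ ⊤ ∧ ∀ z, ballMean w (r n) z ≤ B :=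
    fun n hn => ballMean_le_of_eint_le hW hd hM hn.1 hn.2.le
  have hfin : ∀ n, r n ∈ Ioo (0 : ℝ) 1 → ∀ z, ballMean w (r n) z ≠ ⊤ := fun n hn z => by
    obtain ⟨B, hB, hwB⟩ := hBex n hn
    exact ((hwB z).trans_lt hB.lt_top).ne
  have hae : ∀ᵐ x ∂μ, ∀ n, r n ∈ Ioo (0 : ℝ) 1 → ENNReal.ofReal (r n) < δ →
      ∫⁻ y, symmKernel w (x - y) ∂μ < ⊤ ∧
        ∫⁻ y, symmKernel w (x - y) ∂μ ≤ ∫⁻ y, ballMean (symmKernel w) (r n) (x - y) ∂μ := by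
    rw [ae_all_iff]
    intro n
    by_cases hn : r n ∈ Ioo (0 : ℝ) 1 ∧ ENNReal.ofReal (r n) < δ
    · obtain ⟨B, hB, hwB⟩ := hBex n hn.1
      filter_upwards [ae_potential_le_ballMean hws (symmKernel_neg w) hn.1.1
        (B := B + B) (by finiteness)
        (fun z => by rw [ballMean_symmKernel hw]; exact add_le_add (hwB _) (hwB _)) (μ := μ)
        (fun ν hν hdν => by
          rw [crossEnergy_symmKernel hw, crossEnergy_symmKernel hw]
          gcongr
          exact crossEnergy_shiftKernel_le hW hd (hδmin ν hν (hdν.trans_lt hn.2)))] with x hx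
      exact fun _ _ => hx
    · exact ae_of_all _ fun x h1 h2 => absurd ⟨h1, h2⟩ hn
  set k : ℕ → ℝ≥0∞ := fun n => ENNReal.ofReal (2 * (N + 2) / r n ^ 2) with hk
  have hsub : ∀ᶠ n in atTop, ∀ z, k n * ballMean (symmKernel w) (r n) z ≤
      k n * symmKernel w z + 2 * ENNReal.ofReal L := by
    filter_upwards [hrIoo] with n hn z
    have h := fun z => mul_ballMean_le_of_approxLap_lt hW hd hn.1 (hfin n hn z) hL0.le
      (hL z _ hn)
    rw [ballMean_symmKernel hw, symmKernel, mul_add, mul_add, two_mul, add_add_add_comm]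
    exact add_le_add (h z) (h (-z))
  have hlow : ∀ s ∈ Ioo 0 s₀, ∀ z : Euc N, ‖z‖ < s → ∀ᶠ n in atTop,
      k n * ballMean (symmKernel w) (r n) z + 2 * ENNReal.ofReal (C / 2 / s ^ β) ≤
        k n * symmKernel w z := by
    intro s hs z hz
    have hsβ : 0 < s ^ β := Real.rpow_pos_of_pos hs.1 β
    have key : ∀ z : Euc N, ‖z‖ < s → ∀ᶠ n : ℕ in atTop,
        k n * ballMean w (r n) z + ENNReal.ofReal (C / 2 / s ^ β) ≤ k n * w z := by
      intro z hz
      have hlt : ((C / 2 / s ^ β : ℝ) : EReal) < negGenLap W z := by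
        rcases eq_or_ne z 0 with rfl | hz0
        · rw [h0rep]; exact EReal.coe_lt_top _
        refine lt_of_lt_of_le (EReal.coe_lt_coe_iff.2 ?_) (hCrep z hz0 (hz.trans hs.2))
        have hzβ : 0 < ‖z‖ ^ β := Real.rpow_pos_of_pos (norm_pos_iff.2 hz0) β
        calc C / 2 / s ^ β < C / s ^ β := by gcongr; linarith
          _ ≤ C / ‖z‖ ^ β := by gcongr
      filter_upwards [eventually_lt_of_lt_liminf hlt, hrIoo] with n hn hrn
      exact mul_ballMean_add_le_of_lt_neg_approxLap hW hd hrn.1 (hfin n hrn z)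
        (by positivity) hn
    filter_upwards [key z hz, key (-z) (by rwa [norm_neg])] with n h1 h2
    rw [ballMean_symmKernel hw, symmKernel, mul_add, mul_add, two_mul, add_add_add_comm]
    exact add_le_add h1 h2
  refine ⟨ENNReal.ofReal (2 * L / C), ENNReal.ofReal_ne_top, s₀, hs₀, ?_⟩
  filter_upwards [hae] with x hx s hs
  have hsβ : 0 < s ^ β := Real.rpow_pos_of_pos hs.1 β
  have h := mul_measure_ball_le hws (μ := μ) (Λ := 2 * ENNReal.ofReal L) (by finiteness)
    (k := k) (fun n => ENNReal.ofReal_ne_top) (r := r) (x := x)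
    (hrIoo.mono fun n hn z => by
      rw [ballMean_symmKernel hw]
      exact ENNReal.add_ne_top.2 ⟨hfin n hn z, hfin n hn (-z)⟩)
    hsub (by filter_upwards [hrIoo, hrδ] with n h1 h2 using hx n h1 h2) (hlow s hs)
  rw [mul_assoc, ENNReal.mul_le_mul_iff_right (by simp) (by simp)] at h
  have hb : 0 < C / 2 / s ^ β := by positivity
  rw [mul_comm, ← ENNReal.le_div_iff_mul_le (Or.inl (by simpa using hb))
    (Or.inl ENNReal.ofReal_ne_top), ← ENNReal.ofReal_div_of_pos hb] at h
  refine h.trans_eq ?_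
  rw [ENNReal.ofReal_rpow_of_pos hs.1, ← ENNReal.ofReal_mul (by positivity)]
  congr 1
  field_simp

/-- Theorem 1: under (H1)-(H4), if `μ` is a compactly supported `d_∞`-local
minimizer of the interaction energy and `W` is `β`-repulsive at the origin with `0<β<N`,
then the support of every part `ρ` of `μ` has Hausdorff dimension at least `β`. -/
theorem statement7 {N : ℕ} (W : Euc N → EReal)
    (hH1 : ∃ c : ℝ, ∀ x, ((c : ℝ) : EReal) ≤ W x)
    (hH2 : LowerSemicontinuous W)
    (hH3 : ∃ M : ℝ, 0 < M ∧ ∀ x : Euc N,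
      eint (volume.restrict (ball x 1)) W ≤ ((M : ℝ) : EReal))
    (hH4 : ∃ Cstar : ℝ, 0 < Cstar ∧ ∀ x : Euc N, ∀ ε ∈ Ioo (0 : ℝ) 1,
      approxLap W ε x < ((Cstar : ℝ) : EReal))
    (μ : Measure (Euc N)) (hμ : IsProbabilityMeasure μ)
    (hcpt : IsCompact (msupp μ)) (hmin : IsLocalMinEnergy W μ)
    (β : ℝ) (hβ0 : 0 < β) (hβN : β < N) (hrep : IsBetaRepulsive W β)
    (ρ : Measure (Euc N)) (hρ0 : ρ ≠ 0) (hρμ : ρ ≤ μ) :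
    ENNReal.ofReal β ≤ dimH (msupp ρ) := by
  obtain ⟨M, -, hM⟩ := hH3
  obtain ⟨K, hK, s₀, hs₀, hball⟩ :=
    exists_measure_ball_le hH1 hH2.measurable ⟨M, hM⟩ hH4 hmin hβ0 hrep
  refine le_dimH_of_measure_ball_le hK hβ0 hs₀ hball fun h0 => hρ0 ?_
  rw [← Measure.measure_univ_eq_zero, ← union_compl_self (msupp ρ)]
  exact measure_union_null (le_antisymm ((hρμ _).trans_eq h0) bot_le) (measure_compl_msupp ρ)

end
end

section
/- Let N ≥ 1, 2−N < α < 2, c > 0, ψ ∈ C³(ℝ^N), and define W_α(x) = c·h_α(x) + ψ(x), where h_α(x) = −|x|^α/α for x ≠ 0 and α ≠ 0, h₀(x) = −log|x|, with h_α(0) = 0 if α > 0 and h_α(0) = +∞ if α ≤ 0. Then W_α is (2−α)-repulsive at the origin and satisfies (H4-loc): for every compact subset K of ℝ^N there exists C*_K > 0 such that Δ^ε W_α(x) < C*_K for all x ∈ K and all ε ∈ (0,1). -/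
open MeasureTheory Metric Set Filter
open scoped ENNReal NNReal Topology

noncomputable section

open scoped Classical in
/-- The power-law potential `h_α(x) = -|x|^α/α` (with `h₀(x) = -log|x|`), with
`h_α(0) = 0` if `α > 0` and `h_α(0) = +∞` if `α ≤ 0`. -/
def halpha {N : ℕ} (α : ℝ) (x : Euc N) : EReal :=
  if x = 0 then (if 0 < α then (0 : EReal) else ⊤)
  else if α = 0 then ((-Real.log ‖x‖ : ℝ) : EReal)
  else ((-‖x‖ ^ α / α : ℝ) : EReal)

/-- The Lipschitz bump `(1 - |y|²)₊ / 2`, a potential of the field `-y` on the unit ball. -/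
def quadBump {N : ℕ} (y : Euc N) : ℝ := (1 - min 1 ‖y‖ ^ 2) / 2

lemma quadBump_of_norm_le {N : ℕ} {y : Euc N} (hy : ‖y‖ ≤ 1) : quadBump y = (1 - ‖y‖ ^ 2) / 2 := by
  simp [quadBump, hy]

lemma quadBump_of_one_le_norm {N : ℕ} {y : Euc N} (hy : 1 ≤ ‖y‖) : quadBump y = 0 := by
  simp [quadBump, hy]

lemma quadBump_nonneg {N : ℕ} (y : Euc N) : 0 ≤ quadBump y := by
  have h1 : min 1 ‖y‖ ≤ 1 := min_le_left _ _
  have h0 : 0 ≤ min 1 ‖y‖ := le_min zero_le_one (norm_nonneg y)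
  unfold quadBump
  nlinarith

lemma lipschitzWith_quadBump {N : ℕ} : LipschitzWith 1 (quadBump (N := N)) := by
  refine LipschitzWith.of_dist_le_mul fun a b => ?_
  have ha1 : min 1 ‖a‖ ≤ 1 := min_le_left _ _
  have ha0 : 0 ≤ min 1 ‖a‖ := le_min zero_le_one (norm_nonneg a)
  have hb1 : min 1 ‖b‖ ≤ 1 := min_le_left _ _
  have hb0 : 0 ≤ min 1 ‖b‖ := le_min zero_le_one (norm_nonneg b)
  have hab : |min 1 ‖a‖ - min 1 ‖b‖| ≤ dist a b := by
    rw [dist_eq_norm]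
    refine le_trans ?_ (abs_norm_sub_norm_le a b)
    simpa using abs_min_sub_min_le_max 1 ‖a‖ 1 ‖b‖
  rw [NNReal.coe_one, one_mul, Real.dist_eq]
  refine le_trans ?_ hab
  have : quadBump a - quadBump b
      = -((min 1 ‖a‖ + min 1 ‖b‖) / 2 * (min 1 ‖a‖ - min 1 ‖b‖)) := by
    unfold quadBump; ring
  rw [this, abs_neg, abs_mul, abs_of_nonneg (by positivity)]
  exact mul_le_of_le_one_left (abs_nonneg _) (by linarith)

lemma hasCompactSupport_quadBump {N : ℕ} : HasCompactSupport (quadBump (N := N)) :=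
  HasCompactSupport.intro (isCompact_closedBall 0 1) fun y hy => by
    rw [mem_closedBall_zero_iff, not_le] at hy
    exact quadBump_of_one_le_norm hy.le

lemma lineDeriv_quadBump_of_norm_lt {N : ℕ} {y : Euc N} (hy : ‖y‖ < 1) (v : Euc N) :
    lineDeriv ℝ quadBump y v = -inner ℝ y v := by
  have h : quadBump =ᶠ[𝓝 y] fun z => (1 - ‖z‖ ^ 2) / 2 := by
    filter_upwards [(isOpen_lt continuous_norm continuous_const).mem_nhds hy] with z hz
    exact quadBump_of_norm_le (le_of_lt hz)
  have hd : HasFDerivAt (fun z : Euc N => (1 - ‖z‖ ^ 2) / 2)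
      ((2 : ℝ)⁻¹ • (-((2 : ℕ) • (innerSL ℝ y ∘SL ContinuousLinearMap.id ℝ (Euc N))) :
        Euc N →L[ℝ] ℝ)) y := by
    simpa [div_eq_inv_mul] using (((hasFDerivAt_id y).norm_sq.const_sub 1).const_mul (2 : ℝ)⁻¹)
  rw [h.lineDeriv_eq, hd.differentiableAt.lineDeriv_eq_fderiv, hd.fderiv]
  simp

lemma lineDeriv_quadBump_of_lt_norm {N : ℕ} {y : Euc N} (hy : 1 < ‖y‖) (v : Euc N) :
    lineDeriv ℝ quadBump y v = 0 := by
  have h : quadBump =ᶠ[𝓝 y] fun _ => 0 := by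
    filter_upwards [(isOpen_lt continuous_const continuous_norm).mem_nhds hy] with z hz
    exact quadBump_of_one_le_norm (le_of_lt hz)
  rw [h.lineDeriv_eq]
  simp [lineDeriv]

/-- Integration by parts on the unit ball against the potential of the position field. -/
lemma setIntegral_ball_mul_inner {N : ℕ} {u : Euc N → ℝ} (hu : ContDiff ℝ 1 u) (v : Euc N) :
    ∫ y in ball (0 : Euc N) 1, u y * inner ℝ y v
      = ∫ y in ball (0 : Euc N) 1, fderiv ℝ u y v * quadBump y := by
  let χ : ContDiffBump (0 : Euc N) := ⟨2, 3, by norm_num, by norm_num⟩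
  have hχ : ContDiff ℝ 1 (fun y => χ y * u y) := χ.contDiff.mul hu
  obtain ⟨C, hC⟩ := ContDiff.lipschitzWith_of_hasCompactSupport
    (χ.hasCompactSupport.mul_right (f' := u)) hχ one_ne_zero
  have hχ1 : ∀ y : Euc N, ‖y‖ < 1 → (fun z => χ z * u z) =ᶠ[𝓝 y] u := by
    intro y hy
    filter_upwards [(isOpen_lt continuous_norm continuous_const).mem_nhds hy] with z hz
    rw [χ.one_of_mem_closedBall, one_mul]
    rw [mem_closedBall_zero_iff]
    exact hz.le.trans one_le_two
  have key := hC.integral_lineDeriv_mul_eq (μ := volume) lipschitzWith_quadBump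
    hasCompactSupport_quadBump v
  have hl : ∫ y, lineDeriv ℝ (fun z => χ z * u z) y v * quadBump y
      = ∫ y in ball (0 : Euc N) 1, fderiv ℝ u y v * quadBump y := by
    rw [← integral_indicator measurableSet_ball]
    congr 1 with y
    by_cases hy : ‖y‖ < 1
    · rw [indicator_of_mem (by simpa using hy), (hχ1 y hy).lineDeriv_eq,
        (hu.differentiable one_ne_zero y).lineDeriv_eq_fderiv]
    · rw [indicator_of_notMem (by simpa using hy), quadBump_of_one_le_norm (not_lt.1 hy), mul_zero]
  have hr : ∫ y, lineDeriv ℝ quadBump y (-v) * (χ y * u y)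
      = ∫ y in ball (0 : Euc N) 1, u y * inner ℝ y v := by
    rw [← integral_indicator measurableSet_ball]
    refine integral_congr_ae ?_
    have hs : ∀ᵐ y : Euc N, y ∉ sphere (0 : Euc N) 1 :=
      measure_eq_zero_iff_ae_notMem.1 (Measure.addHaar_sphere_of_ne_zero volume 0 one_ne_zero)
    filter_upwards [hs] with y hy
    rw [mem_sphere_zero_iff_norm] at hy
    rcases lt_or_gt_of_ne hy with h | h
    · rw [indicator_of_mem (by simpa using h), lineDeriv_quadBump_of_norm_lt h,
        (hχ1 y h).eq_of_nhds, inner_neg_right]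
      ring
    · rw [indicator_of_notMem (by simpa using h.le), lineDeriv_quadBump_of_lt_norm h, zero_mul]
  rw [← hl, ← hr]
  exact key.symm

/-- The Laplacian of a function on `ℝ^N`, as the sum of its pure second partial derivatives. -/
def lap {N : ℕ} (f : Euc N → ℝ) (y : Euc N) : ℝ :=
  ∑ i, fderiv ℝ (fun z => fderiv ℝ f z (EuclideanSpace.single i 1)) y (EuclideanSpace.single i 1)

lemma fderiv_apply_eq_sum {N : ℕ} (L : Euc N →L[ℝ] ℝ) (y : Euc N) :
    L y = ∑ i, L (EuclideanSpace.single i 1) * inner ℝ y (EuclideanSpace.single i (1 : ℝ)) := by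
  conv_lhs => rw [← (EuclideanSpace.basisFun (Fin N) ℝ).sum_repr y]
  simp [map_sum, mul_comm, EuclideanSpace.inner_single_right]

lemma ContDiff.fderiv_apply_const {N : ℕ} {f : Euc N → ℝ} (hf : ContDiff ℝ 2 f) (v : Euc N) :
    ContDiff ℝ 1 fun z => fderiv ℝ f z v :=
  (hf.fderiv_right (m := 1) (by norm_num)).clm_apply contDiff_const

lemma continuous_lap {N : ℕ} {f : Euc N → ℝ} (hf : ContDiff ℝ 2 f) : Continuous (lap f) :=
  continuous_finsetSum _ fun i _ =>
    ((hf.fderiv_apply_const (EuclideanSpace.single i 1)).continuous_fderiv one_ne_zero).clm_apply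
      continuous_const

lemma integrableOn_ball_of_continuous {N : ℕ} {f : Euc N → ℝ} (hf : Continuous f) (x : Euc N)
    (r : ℝ) : IntegrableOn f (ball x r) :=
  (hf.continuousOn.integrableOn_compact (isCompact_closedBall x r)).mono_set ball_subset_closedBall

/-- The radial derivative of `f`, integrated over a ball, is a weighted integral of `Δf`. -/
lemma setIntegral_ball_fderiv {N : ℕ} {f : Euc N → ℝ} (hf : ContDiff ℝ 2 f) (x : Euc N) (r : ℝ) :
    ∫ y in ball (0 : Euc N) 1, fderiv ℝ f (x + r • y) y
      = r * ∫ y in ball (0 : Euc N) 1, lap f (x + r • y) * quadBump y := by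
  have hA : ∀ y : Euc N, HasFDerivAt (fun z : Euc N => x + r • z)
      (r • ContinuousLinearMap.id ℝ (Euc N)) y := fun y =>
    ((hasFDerivAt_id y).const_smul r).const_add x
  have hAc : ContDiff ℝ 1 (fun z : Euc N => x + r • z) := by fun_prop
  have hu : ∀ i : Fin N, ContDiff ℝ 1
      (fun y : Euc N => fderiv ℝ f (x + r • y) (EuclideanSpace.single i 1)) := fun i =>
    (hf.fderiv_apply_const (EuclideanSpace.single i 1)).comp hAc
  have hint : ∀ i : Fin N, Integrable (fun y : Euc N =>
      fderiv ℝ f (x + r • y) (EuclideanSpace.single i 1)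
        * inner ℝ y (EuclideanSpace.single i (1 : ℝ))) (volume.restrict (ball 0 1)) := fun i =>
    integrableOn_ball_of_continuous ((hu i).continuous.mul (by fun_prop)) 0 1
  have hint' : ∀ i : Fin N, Integrable (fun y : Euc N =>
      r * (fderiv ℝ (fun z => fderiv ℝ f z (EuclideanSpace.single i 1)) (x + r • y)
        (EuclideanSpace.single i 1) * quadBump y)) (volume.restrict (ball 0 1)) := fun i =>
    integrableOn_ball_of_continuous (continuous_const.mul
      (((((hf.fderiv_apply_const (EuclideanSpace.single i 1)).continuous_fderiv
        one_ne_zero).comp hAc.continuous).clm_apply continuous_const).mul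
        lipschitzWith_quadBump.continuous)) 0 1
  calc ∫ y in ball (0 : Euc N) 1, fderiv ℝ f (x + r • y) y
      = ∫ y in ball (0 : Euc N) 1, ∑ i, fderiv ℝ f (x + r • y) (EuclideanSpace.single i 1)
          * inner ℝ y (EuclideanSpace.single i (1 : ℝ)) := by
        simp_rw [← fderiv_apply_eq_sum]
    _ = ∑ i, ∫ y in ball (0 : Euc N) 1, r *
          (fderiv ℝ (fun z => fderiv ℝ f z (EuclideanSpace.single i 1)) (x + r • y)
            (EuclideanSpace.single i 1) * quadBump y) := by
        rw [integral_finsetSum _ fun i _ => hint i]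
        refine Finset.sum_congr rfl fun i _ => ?_
        rw [setIntegral_ball_mul_inner (hu i)]
        congr 1 with y
        have hd := (((hf.fderiv_apply_const (EuclideanSpace.single i 1)).differentiable
          one_ne_zero (x + r • y)).hasFDerivAt.comp y (hA y)).fderiv
        have hd' : fderiv ℝ (fun y : Euc N => fderiv ℝ f (x + r • y) (EuclideanSpace.single i 1)) y
          = _ := hd
        rw [hd']
        simp [mul_assoc]
    _ = r * ∫ y in ball (0 : Euc N) 1, lap f (x + r • y) * quadBump y := by
        rw [← integral_finsetSum _ fun i _ => hint' i, ← integral_const_mul]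
        simp_rw [lap, Finset.sum_mul, Finset.mul_sum]

lemma hasDerivAt_setIntegral_ball {N : ℕ} {f : Euc N → ℝ} (hf : ContDiff ℝ 1 f) (x : Euc N)
    (r : ℝ) :
    HasDerivAt (fun r : ℝ => ∫ y in ball (0 : Euc N) 1, f (x + r • y))
      (∫ y in ball (0 : Euc N) 1, fderiv ℝ f (x + r • y) y) r := by
  have hc : Continuous fun p : ℝ × Euc N => fderiv ℝ f (x + p.1 • p.2) p.2 :=
    ((hf.continuous_fderiv one_ne_zero).comp (by fun_prop)).clm_apply continuous_snd
  obtain ⟨C, hC⟩ := ((isCompact_Icc (a := r - 1) (b := r + 1)).prod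
    (isCompact_closedBall (0 : Euc N) 1)).exists_bound_of_continuousOn hc.continuousOn
  refine (hasDerivAt_integral_of_dominated_loc_of_deriv_le (s := Icc (r - 1) (r + 1))
    (bound := fun _ => C) (F' := fun r y => fderiv ℝ f (x + r • y) y)
    (Icc_mem_nhds (by linarith) (by linarith)) ?_ ?_ ?_ ?_ ?_ ?_).2
  · exact Eventually.of_forall fun t =>
      (hf.continuous.comp (by fun_prop)).aestronglyMeasurable
  · exact integrableOn_ball_of_continuous (hf.continuous.comp (by fun_prop)) 0 1
  · exact (hc.comp (by fun_prop : Continuous fun y : Euc N => (r, y))).aestronglyMeasurable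
  · filter_upwards [ae_restrict_mem measurableSet_ball] with y hy t ht
    exact hC (t, y) ⟨ht, ball_subset_closedBall hy⟩
  · exact integrableOn_const (measure_ball_lt_top.ne)
  · filter_upwards with y t _
    have h1 : HasDerivAt (fun s : ℝ => x + s • y) y t := by
      simpa using ((hasDerivAt_id t).smul_const y).const_add x
    exact ((hf.differentiable one_ne_zero _).hasFDerivAt.comp_hasDerivAt t h1)

/-- If `Δf ≤ Λ` on a ball, then the average of `f` over the ball exceeds its central value by at
most a dimensional constant times `Λ ε²`. -/
lemma setIntegral_unitBall_sub_le {N : ℕ} {f : Euc N → ℝ} (hf : ContDiff ℝ 2 f) (x : Euc N)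
    {ε Λ : ℝ} (hε : 0 ≤ ε) (hΛ : ∀ y ∈ ball x ε, lap f y ≤ Λ) :
    (∫ y in ball (0 : Euc N) 1, f (x + ε • y)) - (volume.real (ball (0 : Euc N) 1)) * f x
      ≤ ε ^ 2 / 2 * (Λ * ∫ y in ball (0 : Euc N) 1, quadBump y) := by
  set k := ∫ y in ball (0 : Euc N) 1, quadBump y
  set M : ℝ → ℝ := fun r => (∫ y in ball (0 : Euc N) 1, f (x + r • y)) - r ^ 2 / 2 * (Λ * k)
  have hM : ∀ r, HasDerivAt M ((∫ y in ball (0 : Euc N) 1, fderiv ℝ f (x + r • y) y)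
      - r * (Λ * k)) r := by
    intro r
    have h2 : HasDerivAt (fun r : ℝ => r ^ 2 / 2 * (Λ * k)) (r * (Λ * k)) r := by
      refine (((hasDerivAt_pow 2 r).div_const 2).mul_const (Λ * k)).congr_deriv ?_
      ring
    exact (hasDerivAt_setIntegral_ball (hf.of_le (by norm_num)) x r).sub h2
  have hanti : AntitoneOn M (Icc 0 ε) := by
    refine antitoneOn_of_deriv_nonpos (convex_Icc 0 ε)
      (fun r _ => (hM r).continuousAt.continuousWithinAt)
      (fun r _ => (hM r).differentiableAt.differentiableWithinAt) fun r hr => ?_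
    rw [interior_Icc] at hr
    rw [(hM r).deriv, setIntegral_ball_fderiv hf, sub_nonpos]
    refine mul_le_mul_of_nonneg_left ?_ hr.1.le
    rw [← integral_const_mul]
    refine setIntegral_mono_on ?_ ?_ measurableSet_ball fun y hy => ?_
    · exact integrableOn_ball_of_continuous (((continuous_lap hf).comp (by fun_prop)).mul
        lipschitzWith_quadBump.continuous) 0 1
    · exact integrableOn_ball_of_continuous (continuous_const.mul
        lipschitzWith_quadBump.continuous) 0 1
    · refine mul_le_mul_of_nonneg_right (hΛ _ ?_) (quadBump_nonneg y)
      rw [mem_ball_zero_iff] at hy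
      rw [mem_ball_iff_norm, add_sub_cancel_left, norm_smul, Real.norm_of_nonneg hr.1.le]
      nlinarith [hr.1, hr.2, norm_nonneg y]
  have := hanti (left_mem_Icc.2 hε) (right_mem_Icc.2 hε) hε
  have h0 : M 0 = volume.real (ball (0 : Euc N) 1) * f x := by
    simp [M]
  rw [h0] at this
  simp only [M] at this
  linarith

lemma setIntegral_ball_eq_pow_mul {N : ℕ} (f : Euc N → ℝ) {ε : ℝ} (hε : 0 < ε) :
    ∫ y in ball (0 : Euc N) ε, f y = ε ^ N * ∫ y in ball (0 : Euc N) 1, f (ε • y) := by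
  rw [Measure.setIntegral_comp_smul_of_pos volume f _ hε, smul_unitBall_of_pos hε,
    finrank_euclideanSpace_fin, smul_eq_mul, mul_inv_cancel_left₀ (by positivity)]

lemma volume_real_ball {N : ℕ} {ε : ℝ} (hε : 0 < ε) :
    volume.real (ball (0 : Euc N) ε) = ε ^ N * volume.real (ball (0 : Euc N) 1) := by
  rw [measureReal_def, Measure.addHaar_ball_of_pos _ _ hε, ENNReal.toReal_mul,
    ENNReal.toReal_ofReal (by positivity), finrank_euclideanSpace_fin, measureReal_def]

/-- The average of `quadBump` over the unit ball. -/
def quadBumpAvg (N : ℕ) : ℝ :=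
  (volume.real (ball (0 : Euc N) 1))⁻¹ * ∫ y in ball (0 : Euc N) 1, quadBump y

lemma volume_real_ball_pos {N : ℕ} {ε : ℝ} (hε : 0 < ε) :
    0 < volume.real (ball (0 : Euc N) ε) :=
  ENNReal.toReal_pos (measure_ball_pos _ _ hε).ne' measure_ball_lt_top.ne

lemma quadBumpAvg_pos (N : ℕ) : 0 < quadBumpAvg N := by
  refine mul_pos (inv_pos.2 (volume_real_ball_pos one_pos)) ?_
  rw [setIntegral_pos_iff_support_of_nonneg_ae (Eventually.of_forall quadBump_nonneg)
    (integrableOn_ball_of_continuous lipschitzWith_quadBump.continuous 0 1)]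
  refine (measure_ball_pos volume (0 : Euc N) one_pos).trans_le (measure_mono fun y hy => ⟨?_, hy⟩)
  rw [mem_ball_zero_iff] at hy
  rw [Function.mem_support, quadBump_of_norm_le hy.le]
  have : ‖y‖ ^ 2 < 1 := by nlinarith [norm_nonneg y]
  linarith

lemma setIntegral_ball_le {N : ℕ} {f : Euc N → ℝ} (hf : ContDiff ℝ 2 f) (x : Euc N)
    {ε Λ : ℝ} (hε : 0 < ε) (hΛ : ∀ y ∈ ball x ε, lap f y ≤ Λ) :
    ∫ y in ball (0 : Euc N) ε, f (x + y)
      ≤ volume.real (ball (0 : Euc N) ε) * (f x + ε ^ 2 / 2 * (Λ * quadBumpAvg N)) := by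
  have h := setIntegral_unitBall_sub_le hf x hε.le hΛ
  rw [setIntegral_ball_eq_pow_mul (fun y => f (x + y)) hε, volume_real_ball hε, mul_assoc]
  refine mul_le_mul_of_nonneg_left ?_ (by positivity)
  have hV := (volume_real_ball_pos (N := N) one_pos).ne'
  have : volume.real (ball (0 : Euc N) 1) * (f x + ε ^ 2 / 2 * (Λ * quadBumpAvg N))
      = volume.real (ball (0 : Euc N) 1) * f x
        + ε ^ 2 / 2 * (Λ * ∫ y in ball (0 : Euc N) 1, quadBump y) := by
    unfold quadBumpAvg
    field_simp
  linarith

lemma lap_const_mul_add {N : ℕ} {f g : Euc N → ℝ} (hf : ContDiff ℝ 2 f) (hg : ContDiff ℝ 2 g)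
    (c : ℝ) (y : Euc N) : lap (fun z => c * f z + g z) y = c * lap f y + lap g y := by
  unfold lap
  rw [Finset.mul_sum, ← Finset.sum_add_distrib]
  refine Finset.sum_congr rfl fun i _ => ?_
  have h1 : (fun z => fderiv ℝ (fun z => c * f z + g z) z (EuclideanSpace.single i 1))
      = fun z => c * fderiv ℝ f z (EuclideanSpace.single i 1)
        + fderiv ℝ g z (EuclideanSpace.single i 1) := by
    ext z
    have h := (((hf.differentiable two_ne_zero z).hasFDerivAt.const_mul c).add
      (hg.differentiable two_ne_zero z).hasFDerivAt).fderiv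
    have h' : fderiv ℝ (fun z => c * f z + g z) z = _ := h
    rw [h']
    simp
  rw [h1]
  have h := ((((hf.fderiv_apply_const (EuclideanSpace.single i 1)).differentiable
    one_ne_zero y).hasFDerivAt.const_mul c).add
    ((hg.fderiv_apply_const (EuclideanSpace.single i 1)).differentiable
    one_ne_zero y).hasFDerivAt).fderiv
  refine (congrArg (fun L => L (EuclideanSpace.single i 1)) h).trans ?_
  simp

/-- The profile of `h_α` as a function of the squared norm. -/
def powProfile (α s : ℝ) : ℝ := if α = 0 then -Real.log s / 2 else -s ^ (α / 2) / α

lemma halpha_eq_powProfile {N : ℕ} {α : ℝ} {x : Euc N} (hx : x ≠ 0 ∨ 0 < α) :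
    halpha α x = ((powProfile α (‖x‖ ^ 2) : ℝ) : EReal) := by
  have hpow : (‖x‖ ^ 2) ^ (α / 2) = ‖x‖ ^ α := by
    rw [← Real.rpow_natCast_mul (norm_nonneg x)]
    congr 1
    push_cast
    ring
  unfold halpha powProfile
  rw [hpow]
  split_ifs with h0 hα hα' hα''
  · exact absurd hα' hα.ne'
  · simp [h0, Real.zero_rpow hα']
  · exact absurd h0 (hx.resolve_right hα)
  · exact absurd h0 (hx.resolve_right hα)
  · rw [Real.log_pow]
    congr 1
    push_cast
    ring
  · rfl

lemma hasDerivAt_powProfile (α : ℝ) {s : ℝ} (hs : 0 < s) :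
    HasDerivAt (powProfile α) (-(s ^ (α / 2 - 1)) / 2) s := by
  by_cases hα : α = 0
  · subst hα
    have h : powProfile 0 = fun s => -Real.log s / 2 := by ext; simp [powProfile]
    rw [h]
    refine ((Real.hasDerivAt_log hs.ne').neg.div_const 2).congr_deriv ?_
    rw [zero_div, zero_sub, Real.rpow_neg_one]
  · have h : powProfile α = fun s => -s ^ (α / 2) / α := by ext; simp [powProfile, hα]
    rw [h]
    refine ((Real.hasDerivAt_rpow_const (p := α / 2) (Or.inl hs.ne')).neg.div_const α).congr_deriv ?_
    field_simp

lemma powProfile_le {α s t : ℝ} (hs : 0 < s ∨ (0 < α ∧ 0 ≤ s)) (hst : s ≤ t) :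
    powProfile α t ≤ powProfile α s := by
  have hs0 : 0 ≤ s := hs.elim le_of_lt And.right
  unfold powProfile
  rcases lt_trichotomy α 0 with hα | hα | hα
  · have h := Real.rpow_le_rpow_of_nonpos (hs.resolve_right fun h => h.1.not_gt hα) hst
      (by linarith : α / 2 ≤ 0)
    rw [if_neg hα.ne, if_neg hα.ne]
    exact div_le_div_of_nonpos_of_le hα.le (neg_le_neg h)
  · have h := Real.log_le_log (hs.resolve_right fun h => h.1.ne' hα) hst
    rw [if_pos hα, if_pos hα]
    linarith
  · have h := Real.rpow_le_rpow hs0 hst (by linarith : 0 ≤ α / 2)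
    rw [if_neg hα.ne', if_neg hα.ne']
    gcongr

lemma contDiff_powProfile_norm_sq_add {N : ℕ} (α : ℝ) {δ : ℝ} (hδ : 0 < δ) :
    ContDiff ℝ 2 fun y : Euc N => powProfile α (‖y‖ ^ 2 + δ) := by
  have h : ContDiff ℝ 2 fun y : Euc N => ‖y‖ ^ 2 + δ := (contDiff_norm_sq ℝ).add contDiff_const
  have h0 : ∀ y : Euc N, ‖y‖ ^ 2 + δ ≠ 0 := fun y => by positivity
  unfold powProfile
  split_ifs
  · exact (h.log h0).neg.div_const 2
  · exact (h.rpow_const_of_ne h0).neg.div_const α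

/-- The regularised power-law potential is strictly superharmonic. -/
lemma lap_powProfile_le {N : ℕ} {α : ℝ} (hα : α < 2) {δ : ℝ} (hδ : 0 < δ) (y : Euc N) :
    lap (fun z => powProfile α (‖z‖ ^ 2 + δ)) y
      ≤ -((α + N - 2) * (‖y‖ ^ 2 + δ) ^ (α / 2 - 1)) := by
  have hs : ∀ z : Euc N, 0 < ‖z‖ ^ 2 + δ := fun z => by positivity
  have hn : ∀ z : Euc N, HasFDerivAt (fun z : Euc N => ‖z‖ ^ 2 + δ)
      ((2 : ℕ) • (innerSL ℝ z ∘SL ContinuousLinearMap.id ℝ (Euc N)) : Euc N →L[ℝ] ℝ) z :=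
    fun z => (hasFDerivAt_id z).norm_sq.add_const δ
  have h1 : ∀ v : Euc N, (fun z => fderiv ℝ (fun z => powProfile α (‖z‖ ^ 2 + δ)) z v)
      = fun z => -((‖z‖ ^ 2 + δ) ^ (α / 2 - 1) * inner ℝ v z) := by
    intro v
    ext z
    have h := ((hasDerivAt_powProfile α (hs z)).comp_hasFDerivAt z (hn z)).fderiv
    rw [show fderiv ℝ (fun z : Euc N => powProfile α (‖z‖ ^ 2 + δ)) z = _ from h]
    simp [real_inner_comm v z]
    ring
  have h2 : ∀ v : Euc N, fderiv ℝ (fun z => -((‖z‖ ^ 2 + δ) ^ (α / 2 - 1) * inner ℝ v z)) y v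
      = -((α - 2) * (‖y‖ ^ 2 + δ) ^ (α / 2 - 1 - 1) * (inner ℝ y v) ^ 2
        + (‖y‖ ^ 2 + δ) ^ (α / 2 - 1) * ‖v‖ ^ 2) := by
    intro v
    have h : HasFDerivAt (fun z : Euc N => -((‖z‖ ^ 2 + δ) ^ (α / 2 - 1) * inner ℝ v z)) _ y :=
      (((hn y).rpow_const (p := α / 2 - 1) (Or.inl (hs y).ne')).mul
        ((innerSL ℝ v).hasFDerivAt)).neg
    rw [h.fderiv]
    simp [real_inner_comm v y]
    ring
  have hsum : ∑ i : Fin N, (inner ℝ y (EuclideanSpace.single i (1 : ℝ))) ^ 2 = ‖y‖ ^ 2 := by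
    rw [EuclideanSpace.real_norm_sq_eq]
    simp [EuclideanSpace.inner_single_right]
  have hpow : (‖y‖ ^ 2 + δ) ^ (α / 2 - 1)
      = (‖y‖ ^ 2 + δ) ^ (α / 2 - 1 - 1) * (‖y‖ ^ 2 + δ) := by
    rw [← Real.rpow_add_one (hs y).ne']
    congr 1
    ring
  have hlap : lap (fun z => powProfile α (‖z‖ ^ 2 + δ)) y
      = -((α - 2) * (‖y‖ ^ 2 + δ) ^ (α / 2 - 1 - 1) * ‖y‖ ^ 2
        + N * (‖y‖ ^ 2 + δ) ^ (α / 2 - 1)) := by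
    unfold lap
    simp_rw [h1, h2, Finset.sum_neg_distrib, Finset.sum_add_distrib, ← Finset.mul_sum, hsum]
    simp
    ring
  have hp : 0 < (‖y‖ ^ 2 + δ) ^ (α / 2 - 1 - 1) := Real.rpow_pos_of_pos (hs y) _
  rw [hlap, hpow]
  have : 0 ≤ (2 - α) * δ * (‖y‖ ^ 2 + δ) ^ (α / 2 - 1 - 1) :=
    mul_nonneg (mul_nonneg (by linarith) hδ.le) hp.le
  linarith

lemma integrableOn_ball_powProfile {N : ℕ} (hN : 1 ≤ N) {α : ℝ} (hα : 2 - (N : ℝ) < α) (R : ℝ) :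
    IntegrableOn (fun y : Euc N => powProfile α (‖y‖ ^ 2)) (ball 0 R) := by
  have : Nontrivial (Euc N) :=
    Module.nontrivial_of_finrank_pos (R := ℝ) (by rwa [finrank_euclideanSpace_fin])
  refine (integrableOn_fun_norm_addHaar volume (f := fun r => powProfile α (r ^ 2))).2 ?_
  rw [finrank_euclideanSpace_fin]
  rcases le_or_gt R 0 with hR | hR
  · simp [Ioo_eq_empty_of_le hR]
  by_cases hα0 : α = 0
  · subst hα0
    have h : IntegrableOn (fun r : ℝ => r ^ (N - 1) * Real.log r) (Ioo 0 R) :=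
      ((intervalIntegrable_iff_integrableOn_Ioo_of_le hR.le).1
        ((intervalIntegral.intervalIntegrable_log' (a := 0) (b := R)).continuousOn_mul
          (by fun_prop : ContinuousOn (fun r : ℝ => r ^ (N - 1)) _)))
    refine h.neg.congr_fun (fun r hr => ?_) measurableSet_Ioo
    simp [powProfile]
    ring
  · have h : IntegrableOn (fun r : ℝ => r ^ ((N : ℝ) - 1 + α)) (Ioo 0 R) :=
      (intervalIntegral.integrableOn_Ioo_rpow_iff hR).2 (by linarith)
    refine IntegrableOn.congr_fun (h.const_mul (-1 / α)) (fun r hr => ?_) measurableSet_Ioo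
    have hr0 : 0 < r := hr.1
    have hpow : (r ^ 2) ^ (α / 2) = r ^ α := by
      rw [← Real.rpow_natCast_mul hr0.le]
      congr 1
      push_cast
      ring
    have hpow' : r ^ ((N : ℝ) - 1 + α) = r ^ (N - 1) * r ^ α := by
      rw [Real.rpow_add hr0, ← Real.rpow_natCast, Nat.cast_sub hN, Nat.cast_one]
    simp only [powProfile, hα0, if_false, hpow, hpow', smul_eq_mul]
    ring

lemma integrableOn_ball_comp_add {N : ℕ} {g : Euc N → ℝ} (hg : ∀ R, IntegrableOn g (ball 0 R))
    (x : Euc N) (ε : ℝ) : IntegrableOn (fun y => g (x + y)) (ball 0 ε) := by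
  have h : IntegrableOn g (ball x ε) :=
    (hg (‖x‖ + ε)).mono_set (ball_subset_ball' (by rw [dist_zero_right, add_comm]))
  have hpre : (fun y => x + y) ⁻¹' ball x ε = ball (0 : Euc N) ε := by
    ext y
    simp
  rw [← hpre]
  exact ((measurePreserving_add_left volume x).integrableOn_comp_preimage
    (MeasurableEquiv.addLeft x).measurableEmbedding).2 h

lemma ae_add_ne_zero {N : ℕ} (hN : 1 ≤ N) (x : Euc N) : ∀ᵐ y : Euc N, x + y ≠ 0 := by
  have : Nontrivial (Euc N) :=
    Module.nontrivial_of_finrank_pos (R := ℝ) (by rwa [finrank_euclideanSpace_fin])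
  have h : ∀ᵐ y : Euc N, y ∉ ({-x} : Set (Euc N)) :=
    measure_eq_zero_iff_ae_notMem.1 (measure_singleton _)
  filter_upwards [h] with y hy h0
  exact hy (eq_neg_of_add_eq_zero_right h0)

/-- Quantitative superharmonicity of `c h_α + ψ`. -/
lemma setIntegral_ball_powProfile_le {N : ℕ} (hN : 1 ≤ N) {α : ℝ} (hα₁ : 2 - (N : ℝ) < α)
    (hα₂ : α < 2) {c : ℝ} (hc : 0 < c) {ψ : Euc N → ℝ} (hψ : ContDiff ℝ 2 ψ) {x : Euc N}
    (hx : x ≠ 0 ∨ 0 < α) {ε L : ℝ} (hε : 0 < ε) (hL : ∀ y ∈ ball x ε, lap ψ y ≤ L) :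
    ∫ y in ball (0 : Euc N) ε, (c * powProfile α (‖x + y‖ ^ 2) + ψ (x + y))
      ≤ volume.real (ball (0 : Euc N) ε) * (c * powProfile α (‖x‖ ^ 2) + ψ x
        + ε ^ 2 / 2 * ((L - c * ((α + N - 2) * (‖x‖ + ε) ^ (α - 2))) * quadBumpAvg N)) := by
  have hxε : 0 < ‖x‖ + ε := by positivity
  set p := α / 2 - 1 with hp
  set δ : ℕ → ℝ := fun n => 1 / ((n : ℝ) + 1) with hδdef
  have hδ : ∀ n, 0 < δ n := fun n => Nat.one_div_pos_of_nat
  have hδ1 : ∀ n, δ n ≤ 1 := fun n => by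
    simpa [hδdef] using Nat.one_div_le_one_div (α := ℝ) (Nat.zero_le n)
  have hδ0 : Tendsto δ atTop (𝓝 0) := tendsto_one_div_add_atTop_nhds_zero_nat
  have hψc : Continuous fun y => ψ (x + y) := hψ.continuous.comp (by fun_prop)
  have hreg : ∀ n, ∫ y in ball (0 : Euc N) ε, (c * powProfile α (‖x + y‖ ^ 2 + δ n) + ψ (x + y))
      ≤ volume.real (ball (0 : Euc N) ε) * (c * powProfile α (‖x‖ ^ 2) + ψ x
        + ε ^ 2 / 2 * ((L - c * ((α + N - 2) * ((‖x‖ + ε) ^ 2 + δ n) ^ p))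
          * quadBumpAvg N)) := by
    intro n
    have hf := contDiff_powProfile_norm_sq_add (N := N) α (hδ n)
    refine (setIntegral_ball_le (Λ := L - c * ((α + N - 2) * ((‖x‖ + ε) ^ 2 + δ n) ^ p))
      ((contDiff_const.mul hf).add hψ) x hε fun y hy => ?_).trans ?_
    · have hy' : ‖y‖ ≤ ‖x‖ + ε := by
        rw [mem_ball_iff_norm] at hy
        linarith [norm_le_norm_add_norm_sub' y x]
      have hmono : ((‖x‖ + ε) ^ 2 + δ n) ^ p ≤ (‖y‖ ^ 2 + δ n) ^ p :=
        Real.rpow_le_rpow_of_nonpos (by have := hδ n; positivity) (by gcongr) (by linarith)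
      rw [lap_const_mul_add hf hψ]
      have h1 := mul_le_mul_of_nonneg_left (lap_powProfile_le hα₂ (hδ n) y) hc.le
      have h2 := mul_le_mul_of_nonneg_left
        (mul_le_mul_of_nonneg_left hmono (by linarith : 0 ≤ α + N - 2)) hc.le
      linarith [hL y hy]
    · gcongr
      refine powProfile_le ?_ (by linarith [hδ n])
      rcases hx with hx | hx
      · exact Or.inl (by positivity)
      · exact Or.inr ⟨hx, by positivity⟩
  have hlim : Tendsto (fun n => volume.real (ball (0 : Euc N) ε) * (c * powProfile α (‖x‖ ^ 2)
      + ψ x + ε ^ 2 / 2 * ((L - c * ((α + N - 2) * ((‖x‖ + ε) ^ 2 + δ n) ^ p))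
          * quadBumpAvg N))) atTop (𝓝 (volume.real (ball (0 : Euc N) ε)
      * (c * powProfile α (‖x‖ ^ 2) + ψ x
        + ε ^ 2 / 2 * ((L - c * ((α + N - 2) * (‖x‖ + ε) ^ (α - 2))) * quadBumpAvg N)))) := by
    have hpow : (‖x‖ + ε) ^ (α - 2) = ((‖x‖ + ε) ^ 2) ^ p := by
      rw [← Real.rpow_natCast_mul hxε.le]
      congr 1
      push_cast
      ring
    have h : Tendsto (fun n => ((‖x‖ + ε) ^ 2 + δ n) ^ p) atTop (𝓝 ((‖x‖ + ε) ^ (α - 2))) := by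
      rw [hpow]
      have := hδ0.const_add ((‖x‖ + ε) ^ 2)
      rw [add_zero] at this
      exact this.rpow_const (Or.inl (by positivity))
    exact ((((((h.const_mul _).const_mul c).const_sub L).mul_const _).const_mul _).const_add
      _).const_mul _
  refine le_of_tendsto_of_tendsto' (tendsto_integral_of_dominated_convergence
    (fun y => c * (|powProfile α (‖x + y‖ ^ 2)| + |powProfile α (‖x + y‖ ^ 2 + 1)|) + |ψ (x + y)|)
    (fun n => ?_) ?_ (fun n => ?_) ?_) hlim hreg
  · have hf := (contDiff_powProfile_norm_sq_add (N := N) α (hδ n)).continuous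
    exact ((continuous_const.mul (hf.comp (continuous_const.add continuous_id))).add
      hψc).aestronglyMeasurable
  · have hf := (contDiff_powProfile_norm_sq_add (N := N) α one_pos).continuous
    exact ((((integrableOn_ball_comp_add (integrableOn_ball_powProfile hN hα₁) x ε).abs).add
      (integrableOn_ball_of_continuous
        (hf.comp (continuous_const.add continuous_id)) 0 ε).abs).const_mul c).add
      (integrableOn_ball_of_continuous hψc 0 ε).abs
  · filter_upwards [ae_restrict_of_ae (ae_add_ne_zero hN x)] with y hy
    have hpos : 0 < ‖x + y‖ ^ 2 := by positivity
    have h1 : powProfile α (‖x + y‖ ^ 2 + δ n) ≤ powProfile α (‖x + y‖ ^ 2) :=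
      powProfile_le (Or.inl hpos) (by linarith [hδ n])
    have h2 : powProfile α (‖x + y‖ ^ 2 + 1) ≤ powProfile α (‖x + y‖ ^ 2 + δ n) :=
      powProfile_le (Or.inl (by linarith [hδ n])) (by linarith [hδ1 n])
    refine (norm_add_le _ _).trans ?_
    rw [Real.norm_eq_abs, Real.norm_eq_abs, abs_mul, abs_of_pos hc]
    gcongr
    exact (abs_le_max_abs_abs h2 h1).trans
      (max_le (le_add_of_nonneg_left (abs_nonneg _)) (le_add_of_nonneg_right (abs_nonneg _)))
  · filter_upwards [ae_restrict_of_ae (ae_add_ne_zero hN x)] with y hy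
    have hpos : 0 < ‖x + y‖ ^ 2 := by positivity
    have h := hδ0.const_add (‖x + y‖ ^ 2)
    rw [add_zero] at h
    exact (((hasDerivAt_powProfile α hpos).continuousAt.tendsto.comp h).const_mul c).add_const _

lemma eint_coe {X : Type*} [MeasurableSpace X] {μ : Measure X} {f : X → EReal} {g : X → ℝ}
    (hg : Integrable g μ) (hfg : ∀ᵐ x ∂μ, f x = g x) : eint μ f = ((∫ x, g x ∂μ : ℝ) : EReal) := by
  have h1 : ∫⁻ x, erealPos (f x) ∂μ = ∫⁻ x, ENNReal.ofReal (g x) ∂μ :=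
    lintegral_congr_ae (hfg.mono fun x hx => by simp [erealPos, hx])
  have h2 : ∫⁻ x, erealPos (-(f x)) ∂μ = ∫⁻ x, ENNReal.ofReal (-g x) ∂μ :=
    lintegral_congr_ae (hfg.mono fun x hx => by simp [erealPos, hx])
  have hfin : ∀ {u : X → ℝ}, Integrable u μ → ∫⁻ x, ENNReal.ofReal (u x) ∂μ ≠ ⊤ :=
    fun hu => hu.lintegral_lt_top.ne
  unfold eint
  rw [h1, h2, integral_eq_lintegral_pos_part_sub_lintegral_neg_part hg, EReal.coe_sub,
    EReal.coe_ennreal_toReal (hfin hg),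
    EReal.coe_ennreal_toReal (x := ∫⁻ x, ENNReal.ofReal (-g x) ∂μ) (hfin hg.neg)]

lemma approxLap_le {N : ℕ} (hN : 1 ≤ N) {α : ℝ} (hα₁ : 2 - (N : ℝ) < α) (hα₂ : α < 2)
    {c : ℝ} (hc : 0 < c) {ψ : Euc N → ℝ} (hψ : ContDiff ℝ 2 ψ) (x : Euc N) {ε L : ℝ} (hε : 0 < ε)
    (hL : ∀ y ∈ ball x ε, lap ψ y ≤ L) :
    approxLap (fun x : Euc N => ((c : ℝ) : EReal) * halpha α x + ((ψ x : ℝ) : EReal)) ε x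
      ≤ (((N + 2) * quadBumpAvg N * (L - c * ((α + N - 2) * (‖x‖ + ε) ^ (α - 2))) : ℝ) :
        EReal) := by
  have hcoef : 0 < (2 * (N + 2) / ε ^ 2 : ℝ) := by positivity
  by_cases hx : x ≠ 0 ∨ 0 < α
  · have hW : ∀ {z : Euc N}, z ≠ 0 ∨ 0 < α →
        ((c : ℝ) : EReal) * halpha α z + ((ψ z : ℝ) : EReal)
          = ((c * powProfile α (‖z‖ ^ 2) + ψ z : ℝ) : EReal) := fun hz => by
      rw [halpha_eq_powProfile hz, EReal.coe_add, EReal.coe_mul]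
    have hψc : Continuous fun y => ψ (x + y) := hψ.continuous.comp (by fun_prop)
    have hint : Integrable (fun y => c * powProfile α (‖x + y‖ ^ 2) + ψ (x + y))
        (volume.restrict (ball (0 : Euc N) ε)) :=
      ((integrableOn_ball_comp_add (integrableOn_ball_powProfile hN hα₁) x ε).const_mul c).add
        (integrableOn_ball_of_continuous hψc 0 ε)
    have hV := volume_real_ball_pos (N := N) hε
    have hmean := setIntegral_ball_powProfile_le hN hα₁ hα₂ hc hψ hx hε hL
    unfold approxLap ballAvg
    beta_reduce
    rw [eint_coe hint ((ae_restrict_of_ae (ae_add_ne_zero hN x)).mono fun y hy => hW (Or.inl hy)),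
      hW hx, ← EReal.coe_mul, ← EReal.coe_sub, ← EReal.coe_mul, EReal.coe_le_coe_iff,
      ← measureReal_def]
    rw [← inv_mul_le_iff₀ hV] at hmean
    calc _ ≤ 2 * (N + 2) / ε ^ 2 * (ε ^ 2 / 2
          * ((L - c * ((α + N - 2) * (‖x‖ + ε) ^ (α - 2))) * quadBumpAvg N)) := by
          gcongr
          linarith
      _ = _ := by field_simp
  · push Not at hx
    have hW : ((c : ℝ) : EReal) * halpha α x + ((ψ x : ℝ) : EReal) = ⊤ := by
      simp [halpha, hx.1, hx.2.not_gt, EReal.coe_mul_top_of_pos hc]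
    unfold approxLap
    beta_reduce
    rw [hW, EReal.sub_top, EReal.coe_mul_bot_of_pos hcoef]
    exact bot_le

/-- for `2-N < α < 2`, `c > 0` and `ψ ∈ C³(ℝ^N)`, the potential
`W_α = c h_α + ψ` is `(2-α)`-repulsive at the origin and satisfies (H4-loc). -/
theorem statement8 {N : ℕ} (hN : 1 ≤ N) (α : ℝ) (hα₁ : 2 - (N : ℝ) < α) (hα₂ : α < 2)
    (c : ℝ) (hc : 0 < c) (ψ : Euc N → ℝ) (hψ : ContDiff ℝ 3 ψ) :
    IsBetaRepulsive (fun x : Euc N => ((c : ℝ) : EReal) * halpha α x + ((ψ x : ℝ) : EReal))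
      (2 - α) ∧
    ∀ K : Set (Euc N), IsCompact K → ∃ CK : ℝ, 0 < CK ∧
      ∀ x ∈ K, ∀ ε ∈ Ioo (0 : ℝ) 1,
        approxLap (fun x : Euc N => ((c : ℝ) : EReal) * halpha α x + ((ψ x : ℝ) : EReal)) ε x
          < ((CK : ℝ) : EReal) := by
  have hψ2 : ContDiff ℝ 2 ψ := hψ.of_le (by norm_num)
  have hbound : ∀ R : ℝ, ∃ L, 0 < L ∧ ∀ y ∈ closedBall (0 : Euc N) R, lap ψ y ≤ L := by
    intro R
    obtain ⟨C, hC⟩ := (isCompact_closedBall (0 : Euc N) R).exists_bound_of_continuousOn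
      (continuous_lap hψ2).continuousOn
    exact ⟨|C| + 1, by positivity, fun y hy => by
      linarith [(le_abs_self _).trans (hC y hy), le_abs_self C]⟩
  set W : Euc N → EReal := fun x => ((c : ℝ) : EReal) * halpha α x + ((ψ x : ℝ) : EReal)
  have hκ : 0 < (N + 2) * quadBumpAvg N := mul_pos (by positivity) (quadBumpAvg_pos N)
  set κ := (N + 2) * quadBumpAvg N
  have hA : 0 < c * (α + N - 2) := mul_pos hc (by linarith)
  set A := c * (α + N - 2)
  have hlap : ∀ (R L : ℝ), (∀ y ∈ closedBall (0 : Euc N) (R + 1), lap ψ y ≤ L) →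
      ∀ x : Euc N, ‖x‖ ≤ R → ∀ ε : ℝ, 0 < ε → ε ≤ 1 →
        approxLap W ε x ≤ ((κ * (L - A * (‖x‖ + ε) ^ (α - 2)) : ℝ) : EReal) := by
    intro R L hL x hx ε hε hε1
    rw [mul_assoc c]
    refine approxLap_le hN hα₁ hα₂ hc hψ2 x hε fun y hy => hL y ?_
    rw [mem_ball_iff_norm] at hy
    rw [mem_closedBall_zero_iff]
    linarith [norm_le_norm_add_norm_sub' y x]
  obtain ⟨L, -, hL⟩ := hbound (1 + 1)
  have hinv : Tendsto (fun n : ℕ => 1 / (n : ℝ)) atTop (𝓝[>] 0) := by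
    simpa [Function.comp_def] using
      tendsto_inv_atTop_nhdsGT_zero.comp (tendsto_natCast_atTop_atTop (R := ℝ))
  have hsmall : ∀ r : ℝ, 0 < r → ∀ᶠ n : ℕ in atTop, 1 / (n : ℝ) ∈ Ioo 0 r := fun r hr =>
    hinv (Ioo_mem_nhdsGT hr)
  have hpow : Tendsto (fun r : ℝ => r ^ (α - 2)) (𝓝[>] 0) atTop :=
    tendsto_rpow_neg_nhdsGT_zero (by linarith)
  refine ⟨⟨?_, ?_⟩, fun K hK => ?_⟩
  · have hB : 0 < A * 2 ^ (α - 2) / 2 := by positivity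
    obtain ⟨r, hr, hr'⟩ := mem_nhdsGT_iff_exists_Ioo_subset.1
      ((hpow.const_mul_atTop hB).eventually_ge_atTop L)
    refine ⟨min 1 r, lt_min one_pos hr, κ * (A * 2 ^ (α - 2) / 2), mul_pos hκ hB,
      fun x hx0 hx => le_liminf_of_le (by isBoundedDefault) ?_⟩
    have hx1 : 0 < ‖x‖ := norm_pos_iff.2 hx0
    filter_upwards [hsmall ‖x‖ hx1] with n hn
    have hx2 := hx.trans_le (min_le_left 1 r)
    refine EReal.le_neg_of_le_neg ((hlap 1 L hL x hx2.le _ hn.1 (hn.2.trans hx2).le).trans ?_)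
    rw [← EReal.coe_neg, EReal.coe_le_coe_iff]
    have h1 : (2 * ‖x‖) ^ (α - 2) ≤ (‖x‖ + 1 / (n : ℝ)) ^ (α - 2) :=
      Real.rpow_le_rpow_of_nonpos (by linarith [hn.1]) (by linarith [hn.2]) (by linarith)
    rw [Real.mul_rpow zero_le_two hx1.le] at h1
    have h2 : L ≤ A * 2 ^ (α - 2) / 2 * ‖x‖ ^ (α - 2) := hr' ⟨hx1, hx.trans_le (min_le_right 1 r)⟩
    have h3 : ‖x‖ ^ (α - 2) = (‖x‖ ^ (2 - α))⁻¹ := by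
      rw [← Real.rpow_neg hx1.le, neg_sub]
    rw [div_eq_mul_inv _ (‖x‖ ^ (2 - α)), ← h3, mul_assoc κ, ← mul_neg]
    refine mul_le_mul_of_nonneg_left ?_ hκ.le
    have h4 := mul_le_mul_of_nonneg_left h1 hA.le
    linarith
  · refine Tendsto.liminf_eq (tendsto_nhds_top_mono
      (f := fun n : ℕ => ((κ * (A * (1 / (n : ℝ)) ^ (α - 2) - L) : ℝ) : EReal)) ?_ ?_)
    · exact EReal.tendsto_coe_nhds_top_iff.2 ((tendsto_atTop_add_const_right _ (-L)
        ((hpow.comp hinv).const_mul_atTop hA)).const_mul_atTop hκ)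
    · filter_upwards [hsmall 1 one_pos] with n hn
      refine EReal.le_neg_of_le_neg ((hlap 1 L hL 0 (by simp) _ hn.1 hn.2.le).trans ?_)
      rw [← EReal.coe_neg, EReal.coe_le_coe_iff, norm_zero, zero_add, ← mul_neg, neg_sub]
  · obtain ⟨R, hR⟩ := hK.isBounded.exists_norm_le
    obtain ⟨L', hLpos, hL'⟩ := hbound (R + 1)
    refine ⟨κ * L' + 1, by positivity, fun x hx ε hε => ?_⟩
    refine (hlap R L' hL' x (hR x hx) ε hε.1 hε.2.le).trans_lt ?_
    rw [EReal.coe_lt_coe_iff]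
    have h : 0 < κ * (A * (‖x‖ + ε) ^ (α - 2)) := by
      have := hε.1
      positivity
    linarith

end
end
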